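/- arXiv:1304.6703 — 2 statements merged into one kernel-verified Lean document; each statement's English description precedes it below -/
import Mathlib

section
/- Let f_i(λ) = (σ_i²/2π)·|1 − e^{iλ}|^{−2d_i} for λ ∈ (−π,π]\{0}, i = 1,2, be the spectral densities of two ARFIMA(0,d_i,0) processes, with 0 < σ_i² < ∞ and 0 < d_i < 1/2. Let ν ∈ ℕ and suppose d₁ + d₂ < 1/(2ν). Then for every ε > 0, Δ_{ν}(T) := | (1/T)·tr[(B_T(f₁)B_T(f₂))^ν] − (2π)^{2ν−1} ∫_{−π}^{π} (f₁(λ)f₂(λ))^ν dλ | = O(T^{−γ+ε}) as T → ∞, where γ = 1/(2ν) − (d₁ + d₂). -/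
open MeasureTheory Filter Set Asymptotics Real
open scoped ENNReal Topology

noncomputable section

/-- Fourier coefficient on the torus. -/
def fcT (h : ℝ → ℝ) (t : ℤ) : ℂ :=
  ∫ x in Ioc (-π) π, Complex.exp (Complex.I * x * t) * (h x)

/-- T × T Toeplitz matrix. -/
def BT (n : ℕ) (h : ℝ → ℝ) : Matrix (Fin n) (Fin n) ℂ :=
  fun s t => fcT h ((s : ℤ) - (t : ℤ))

/-- Polynomial weight on the integers. -/
def wt (a : ℝ) (k : ℤ) : ℝ := (1 + |(k : ℝ)|) ^ (a - 1)

lemma wt_nonneg (a : ℝ) (k : ℤ) : 0 ≤ wt a k := by unfold wt; positivity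

lemma wt_neg (a : ℝ) (k : ℤ) : wt a (-k) = wt a k := by simp [wt]

lemma wt_mono {a b : ℝ} (h : a ≤ b) (k : ℤ) : wt a k ≤ wt b k := by
  unfold wt
  apply Real.rpow_le_rpow_of_exponent_le
  · linarith [abs_nonneg (k : ℝ)]
  · linarith

lemma wt_summable {a : ℝ} (h : a < 0) : Summable (wt a) := by
  have h1 : Summable (fun n : ℕ => (1 + (n : ℝ)) ^ (a - 1)) := by
    have := (summable_nat_add_iff 1).2 (Real.summable_nat_rpow.2 (show a - 1 < -1 by linarith))
    refine this.congr fun n => ?_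
    push_cast
    rw [add_comm]
  apply Summable.of_nat_of_neg
  · refine h1.congr fun n => ?_
    simp [wt]
  · refine h1.congr fun n => ?_
    simp [wt]

lemma core_half {a b c x y z : ℝ} (ha : 0 ≤ a) (hb : 0 ≤ b) (habc : a + b < c) (hc : c ≤ 1)
    (hx : 1 ≤ x) (hy : 1 ≤ y) (hz : 1 ≤ z) (hxyz : z ≤ x + y) (hxy : x ≤ y) :
    x ^ (a - 1) * y ^ (b - 1) ≤ 2 * z ^ (c - 1) * x ^ (a + b - c - 1) := by
  have hx0 : 0 < x := by linarith
  have hy0 : 0 < y := by linarith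
  have hz0 : 0 < z := by linarith
  have e1 : y ^ (b - 1) = y ^ (c - 1) * y ^ (b - c) := by
    rw [← Real.rpow_add hy0]; ring_nf
  have e2 : x ^ (a + b - c - 1) = x ^ (a - 1) * x ^ (b - c) := by
    rw [← Real.rpow_add hx0]; ring_nf
  have i1 : y ^ (c - 1) ≤ 2 * z ^ (c - 1) := by
    have h1 : y ^ (c - 1) ≤ (z / 2) ^ (c - 1) :=
      Real.rpow_le_rpow_of_nonpos (by positivity) (by linarith) (by linarith)
    have h2 : (z / 2) ^ (c - 1) = z ^ (c - 1) * 2 ^ (1 - c) := by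
      rw [Real.div_rpow hz0.le (by norm_num), show (1 - c) = -(c - 1) by ring,
        Real.rpow_neg (by norm_num)]
      rfl
    have h3 : (2 : ℝ) ^ (1 - c) ≤ 2 := by
      calc (2 : ℝ) ^ (1 - c) ≤ 2 ^ (1 : ℝ) :=
            Real.rpow_le_rpow_of_exponent_le (by norm_num) (by linarith)
        _ = 2 := by simp
    have h4 : 0 ≤ z ^ (c - 1) := by positivity
    nlinarith
  have i2 : y ^ (b - c) ≤ x ^ (b - c) :=
    Real.rpow_le_rpow_of_nonpos hx0 hxy (by linarith)
  rw [e1, e2]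
  have p1 : 0 ≤ x ^ (a - 1) := by positivity
  have p2 : 0 ≤ z ^ (c - 1) := by positivity
  have p3 : 0 ≤ y ^ (b - c) := by positivity
  calc x ^ (a - 1) * (y ^ (c - 1) * y ^ (b - c))
      ≤ x ^ (a - 1) * ((2 * z ^ (c - 1)) * x ^ (b - c)) := by gcongr
    _ = _ := by ring

lemma core_full {a b c x y z : ℝ} (ha : 0 ≤ a) (hb : 0 ≤ b) (habc : a + b < c) (hc : c ≤ 1)
    (hx : 1 ≤ x) (hy : 1 ≤ y) (hz : 1 ≤ z) (hxyz : z ≤ x + y) :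
    x ^ (a - 1) * y ^ (b - 1)
      ≤ 2 * z ^ (c - 1) * (x ^ (a + b - c - 1) + y ^ (a + b - c - 1)) := by
  have hx0 : 0 < x := by linarith
  have hy0 : 0 < y := by linarith
  have hz0 : 0 < z := by linarith
  have p1 : 0 ≤ 2 * z ^ (c - 1) * x ^ (a + b - c - 1) := by positivity
  have p2 : 0 ≤ 2 * z ^ (c - 1) * y ^ (a + b - c - 1) := by positivity
  rcases le_total x y with h | h
  · have := core_half ha hb habc hc hx hy hz hxyz h
    linarith
  · have := core_half hb ha (by linarith) hc hy hx hz (by linarith) h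
    rw [show b + a - c - 1 = a + b - c - 1 by ring] at this
    linarith

lemma wt_conv_point {a b c : ℝ} (ha : 0 ≤ a) (hb : 0 ≤ b) (habc : a + b < c) (hc : c ≤ 1)
    (k j : ℤ) :
    wt a j * wt b (k - j) ≤ 2 * wt c k * (wt (a + b - c) j + wt (a + b - c) (k - j)) := by
  unfold wt
  refine core_full ha hb habc hc ?_ ?_ ?_ ?_
  · linarith [abs_nonneg (j : ℝ)]
  · linarith [abs_nonneg (((k - j : ℤ)) : ℝ)]
  · linarith [abs_nonneg (k : ℝ)]
  · push_cast
    have := abs_add_le (j : ℝ) ((k : ℝ) - j)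
    rw [add_sub_cancel] at this
    linarith

lemma wt_conv {a b c : ℝ} (ha : 0 ≤ a) (hb : 0 ≤ b) (habc : a + b < c) (hc : c ≤ 1) :
    ∃ C, 0 ≤ C ∧ ∀ k, Summable (fun j => wt a j * wt b (k - j)) ∧
      ∑' j, wt a j * wt b (k - j) ≤ C * wt c k := by
  have hs : Summable (wt (a + b - c)) := wt_summable (by linarith)
  refine ⟨4 * ∑' j, wt (a + b - c) j, ?_, fun k => ?_⟩
  · have : 0 ≤ ∑' j, wt (a + b - c) j := tsum_nonneg (fun j => wt_nonneg (a + b - c) j)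
    positivity
  have hs2 : Summable (fun j => wt (a + b - c) (k - j)) :=
    (Equiv.subLeft k).summable_iff.2 hs
  have e2 : ∑' j, wt (a + b - c) (k - j) = ∑' j, wt (a + b - c) j :=
    (Equiv.subLeft k).tsum_eq (wt (a + b - c))
  have hs3 := (hs.add hs2).mul_left (2 * wt c k)
  have hsum : Summable (fun j => wt a j * wt b (k - j)) :=
    Summable.of_nonneg_of_le (fun j => mul_nonneg (wt_nonneg _ _) (wt_nonneg _ _))
      (wt_conv_point ha hb habc hc k) hs3
  refine ⟨hsum, ?_⟩
  calc _ ≤ ∑' j, 2 * wt c k * (wt (a + b - c) j + wt (a + b - c) (k - j)) :=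
        hsum.tsum_le_tsum (wt_conv_point ha hb habc hc k) hs3
    _ = _ := by
        rw [tsum_mul_left, hs.tsum_add hs2, e2]; ring

lemma sum_fin_le_tsum {F : ℤ → ℝ} (h0 : ∀ j, 0 ≤ F j) (hF : Summable F) (n : ℕ) :
    ∑ t : Fin n, F ((t : ℕ) : ℤ) ≤ ∑' j, F j := by
  have hi : Function.Injective (fun t : Fin n => ((t : ℕ) : ℤ)) := by
    intro s t h
    simpa [Fin.ext_iff] using h
  have := hF.sum_le_tsum (Finset.univ.map ⟨_, hi⟩) (fun j _ => h0 j)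
  simpa using this

lemma wt_conv_fin {a b c : ℝ} (ha : 0 ≤ a) (hb : 0 ≤ b) (habc : a + b < c) (hc : c ≤ 1) :
    ∃ C, 0 ≤ C ∧ ∀ (n : ℕ) (u s : ℤ),
      ∑ t : Fin n, wt a (u - ((t : ℕ) : ℤ)) * wt b (((t : ℕ) : ℤ) - s) ≤ C * wt c (u - s) := by
  obtain ⟨C, hC, h⟩ := wt_conv ha hb habc hc
  refine ⟨C, hC, fun n u s => ?_⟩
  obtain ⟨h1, h2⟩ := h (u - s)
  have e : ∀ t : ℤ, wt a (u - t) * wt b (t - s)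
      = (fun j => wt a j * wt b (u - s - j)) ((Equiv.subLeft u) t) := by
    intro t; simp
  have hs : Summable (fun t : ℤ => wt a (u - t) * wt b (t - s)) := by
    exact ((Equiv.subLeft u).summable_iff.2 h1).congr fun t => (e t).symm
  have he : ∑' t : ℤ, wt a (u - t) * wt b (t - s) = ∑' j, wt a j * wt b (u - s - j) := by
    rw [tsum_congr e]
    exact (Equiv.subLeft u).tsum_eq (fun j => wt a j * wt b (u - s - j))
  have := sum_fin_le_tsum (F := fun t : ℤ => wt a (u - t) * wt b (t - s))
    (fun j => mul_nonneg (wt_nonneg _ _) (wt_nonneg _ _)) hs n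
  rw [he] at this
  exact this.trans h2

lemma sum_rpow_le {S : ℝ} (hS : 0 < S) (hS1 : S ≤ 1) (n : ℕ) :
    ∑ s ∈ Finset.range n, (1 + (s : ℝ)) ^ (S - 1) ≤ S⁻¹ * (n : ℝ) ^ S := by
  induction n with
  | zero => simp [Real.zero_rpow hS.ne']
  | succ n ih =>
    rw [Finset.sum_range_succ]
    have hn : (0 : ℝ) < 1 + n := by positivity
    have hb := rpow_one_add_le_one_add_mul_self (s := -(1 + (n : ℝ))⁻¹) (p := S)
      (by rw [neg_le_neg_iff]; exact inv_le_one_of_one_le₀ (by linarith [Nat.cast_nonneg (α := ℝ) n])) hS.le hS1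
    have e1 : 1 + -(1 + (n : ℝ))⁻¹ = n / (1 + n) := by field_simp; ring
    rw [e1, Real.div_rpow (by positivity) hn.le, div_le_iff₀ (by positivity)] at hb
    have e2 : (1 + (n : ℝ)) ^ (S - 1) = (1 + (n : ℝ)) ^ S * (1 + (n : ℝ))⁻¹ := by
      rw [Real.rpow_sub_one hn.ne']; rfl
    have key : (n : ℝ) ^ S + S * (1 + (n : ℝ)) ^ (S - 1) ≤ (1 + (n : ℝ)) ^ S := by
      rw [e2]; linarith
    push_cast
    rw [add_comm (n : ℝ) 1]
    calc _ ≤ S⁻¹ * (n : ℝ) ^ S + (1 + (n : ℝ)) ^ (S - 1) := by gcongr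
      _ = S⁻¹ * ((n : ℝ) ^ S + S * (1 + (n : ℝ)) ^ (S - 1)) := by field_simp
      _ ≤ _ := by gcongr

/-- Indicator of the complement of `[0,n)`. -/
def outI (n : ℕ) (u : ℤ) : ℝ := if 0 ≤ u ∧ u < n then 0 else 1

lemma outI_nonneg (n : ℕ) (u : ℤ) : 0 ≤ outI n u := by unfold outI; split_ifs <;> norm_num

lemma outI_le (n : ℕ) (u : ℤ) : outI n u ≤ 1 := by unfold outI; split_ifs <;> norm_num

lemma out_point {S S' : ℝ} (hS1 : S ≤ 1) (n s : ℕ) (hs : s < n) (u : ℤ) :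
    outI n u * wt (S' - 1) ((s : ℤ) - u) ≤
      ((1 + (s : ℝ)) ^ (S - 1) + (1 + ((n - 1 - s : ℕ) : ℝ)) ^ (S - 1)) *
        wt (S' - S) ((s : ℤ) - u) := by
  have q1 : (0 : ℝ) ≤ (1 + (s : ℝ)) ^ (S - 1) := by positivity
  have q2 : (0 : ℝ) ≤ (1 + ((n - 1 - s : ℕ) : ℝ)) ^ (S - 1) := by positivity
  have q3 := wt_nonneg (S' - S) ((s : ℤ) - u)
  unfold outI
  split_ifs with h
  · rw [zero_mul]; positivity
  rw [one_mul]
  have e : wt (S' - 1) ((s : ℤ) - u) = wt S ((s : ℤ) - u) * wt (S' - S) ((s : ℤ) - u) := by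
    unfold wt
    rw [← Real.rpow_add (by positivity)]; ring_nf
  rw [e]
  refine mul_le_mul_of_nonneg_right ?_ q3
  have hu : u < 0 ∨ (n : ℤ) ≤ u := by omega
  rcases hu with hu | hu
  · have : wt S ((s : ℤ) - u) ≤ (1 + (s : ℝ)) ^ (S - 1) := by
      unfold wt
      refine Real.rpow_le_rpow_of_nonpos (by positivity) ?_ (by linarith)
      have h2 : (u : ℝ) < 0 := by exact_mod_cast hu
      push_cast
      linarith [le_abs_self ((s : ℝ) - u)]
    linarith
  · have : wt S ((s : ℤ) - u) ≤ (1 + ((n - 1 - s : ℕ) : ℝ)) ^ (S - 1) := by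
      unfold wt
      refine Real.rpow_le_rpow_of_nonpos (by positivity) ?_ (by linarith)
      have h2 : ((n - 1 - s : ℕ) : ℤ) ≤ u - s := by omega
      have h3 : ((n - 1 - s : ℕ) : ℝ) ≤ u - s := by exact_mod_cast h2
      push_cast at h3 ⊢
      linarith [neg_abs_le ((s : ℝ) - u)]
    linarith

lemma out_sum {S S' : ℝ} (hS : 0 < S) (hS1 : S ≤ 1) (hSS : S' < S) :
    ∃ C, 0 ≤ C ∧ ∀ n : ℕ,
      ∑ s : Fin n, ∑' u : ℤ, outI n u * wt (S' - 1) (((s : ℕ) : ℤ) - u) ≤ C * (n : ℝ) ^ S := by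
  have hs : Summable (wt (S' - S)) := wt_summable (by linarith)
  have hs1 : Summable (wt (S' - 1)) := wt_summable (by linarith)
  set Z := ∑' j, wt (S' - S) j with hZ
  have hZ0 : 0 ≤ Z := tsum_nonneg (fun j => wt_nonneg _ j)
  refine ⟨2 * S⁻¹ * Z, by positivity, fun n => ?_⟩
  have hb : ∀ s : Fin n, ∑' u : ℤ, outI n u * wt (S' - 1) (((s : ℕ) : ℤ) - u) ≤
      ((1 + ((s : ℕ) : ℝ)) ^ (S - 1) + (1 + ((n - 1 - (s : ℕ) : ℕ) : ℝ)) ^ (S - 1)) * Z := by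
    intro s
    have a1 : Summable (fun u => wt (S' - S) (((s : ℕ) : ℤ) - u)) :=
      (Equiv.subLeft ((s : ℕ) : ℤ)).summable_iff.2 hs
    have a2 : ∑' u, wt (S' - S) (((s : ℕ) : ℤ) - u) = Z :=
      (Equiv.subLeft ((s : ℕ) : ℤ)).tsum_eq (wt (S' - S))
    have a3 := a1.mul_left ((1 + ((s : ℕ) : ℝ)) ^ (S - 1) +
      (1 + ((n - 1 - (s : ℕ) : ℕ) : ℝ)) ^ (S - 1))
    have hp := fun u => out_point (S := S) (S' := S') hS1 n s s.2 u
    rw [← a2, ← tsum_mul_left]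
    refine Summable.tsum_le_tsum hp (Summable.of_nonneg_of_le (fun u => ?_) hp a3) a3
    exact mul_nonneg (outI_nonneg _ _) (wt_nonneg _ _)
  have c1 := sum_rpow_le hS hS1 n
  have c2 : ∑ s ∈ Finset.range n, (1 + ((n - 1 - s : ℕ) : ℝ)) ^ (S - 1) ≤ S⁻¹ * (n : ℝ) ^ S := by
    rw [Finset.sum_range_reflect (fun s : ℕ => (1 + (s : ℝ)) ^ (S - 1)) n]
    exact c1
  calc _ ≤ ∑ s : Fin n, ((1 + ((s : ℕ) : ℝ)) ^ (S - 1) +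
          (1 + ((n - 1 - (s : ℕ) : ℕ) : ℝ)) ^ (S - 1)) * Z := Finset.sum_le_sum fun s _ => hb s
    _ = (∑ s ∈ Finset.range n, (1 + (s : ℝ)) ^ (S - 1) +
          ∑ s ∈ Finset.range n, (1 + ((n - 1 - s : ℕ) : ℝ)) ^ (S - 1)) * Z := by
        rw [← Finset.sum_mul, ← Finset.sum_add_distrib, Finset.sum_range]
    _ ≤ (S⁻¹ * (n : ℝ) ^ S + S⁻¹ * (n : ℝ) ^ S) * Z := by gcongr
    _ = _ := by ring

/-- Convolution of two sequences on the integers. -/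
def cv (c e : ℤ → ℂ) (k : ℤ) : ℂ := tsum (fun j : ℤ => c j * e (k - j))

/-- Uniform decay of a family of sequences. -/
def Dom (A : ℝ) (c : ℕ → ℤ → ℂ) : Prop :=
  ∀ B, A < B → B ≤ 1 → ∃ C, 0 ≤ C ∧ ∀ i k, ‖c i k‖ ≤ C * wt B k

/-- Uniform bound for the Toeplitz product error. -/
def Err (A : ℝ) (L : ℕ → ℤ → ℂ) (M : ℕ → (n : ℕ) → Matrix (Fin n) (Fin n) ℂ) : Prop :=
  ∀ b S, 0 ≤ b → A + b < S → S ≤ 1 → ∃ C, 0 ≤ C ∧ ∀ i n,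
    ∑ s : Fin n, ∑ t : Fin n,
      ‖L i (((s : ℕ) : ℤ) - ((t : ℕ) : ℤ)) - M i n s t‖ * wt b (((t : ℕ) : ℤ) - ((s : ℕ) : ℤ))
        ≤ C * (n : ℝ) ^ S

/-- Toeplitz matrix of a sequence. -/
def Tp (n : ℕ) (c : ℤ → ℂ) : Matrix (Fin n) (Fin n) ℂ :=
  fun s t => c (((s : ℕ) : ℤ) - ((t : ℕ) : ℤ))

lemma cv_norm {c c' : ℤ → ℂ} {A B D C C' K : ℝ} (hC : 0 ≤ C) (hC' : 0 ≤ C')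
    (h : ∀ k, ‖c k‖ ≤ C * wt A k) (h' : ∀ k, ‖c' k‖ ≤ C' * wt B k) (k : ℤ)
    (hs : Summable (fun j => wt A j * wt B (k - j)))
    (hb : ∑' j, wt A j * wt B (k - j) ≤ K * wt D k) :
    ‖cv c c' k‖ ≤ C * C' * K * wt D k := by
  have hp : ∀ j, ‖c j * c' (k - j)‖ ≤ C * C' * (wt A j * wt B (k - j)) := by
    intro j
    rw [norm_mul]
    calc _ ≤ (C * wt A j) * (C' * wt B (k - j)) :=
          mul_le_mul (h _) (h' _) (norm_nonneg _) (mul_nonneg hC (wt_nonneg _ _))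
      _ = _ := by ring
  have := tsum_of_norm_bounded (hs.mul_left (C * C')).hasSum hp
  rw [tsum_mul_left] at this
  calc _ ≤ _ := this
    _ ≤ C * C' * (K * wt D k) := by gcongr
    _ = _ := by ring

lemma Dom.cv {A B : ℝ} {c c' : ℕ → ℤ → ℂ} (h : Dom A c) (h' : Dom B c') (hA : 0 ≤ A) (hB : 0 ≤ B) :
    Dom (A + B) (fun i => cv (c i) (c' i)) := by
  intro D hD hD1
  set δ := (D - A - B) / 3 with hδ
  have hδ0 : 0 < δ := by rw [hδ]; linarith
  obtain ⟨C, hC, h1⟩ := h (A + δ) (by linarith) (by linarith)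
  obtain ⟨C', hC', h1'⟩ := h' (B + δ) (by linarith) (by linarith)
  obtain ⟨K, hK, h2⟩ := wt_conv (a := A + δ) (b := B + δ) (c := D) (by linarith) (by linarith)
    (by linarith) hD1
  exact ⟨C * C' * K, by positivity, fun i k =>
    cv_norm hC hC' (h1 i) (h1' i) k (h2 k).1 (h2 k).2⟩

lemma tsum_split {F : ℤ → ℂ} (hF : Summable F) (n : ℕ) :
    ∑' u, F u = ∑' u, (outI n u : ℂ) * F u + ∑ u : Fin n, F ((u : ℕ) : ℤ) := by
  have e : ∑ u : Fin n, F ((u : ℕ) : ℤ) = ∑' u : ℤ, (1 - (outI n u : ℂ)) * F u := by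
    have hi : Function.Injective (fun t : Fin n => ((t : ℕ) : ℤ)) := by
      intro s t h
      simpa [Fin.ext_iff] using h
    rw [tsum_eq_sum (s := Finset.univ.map ⟨_, hi⟩)]
    · rw [Finset.sum_map]
      refine Finset.sum_congr rfl fun u _ => ?_
      simp [outI]
    · intro u hu
      have : ¬ (0 ≤ u ∧ u < n) := by
        rintro ⟨h1, h2⟩
        apply hu
        simp only [Finset.mem_map, Finset.mem_univ, true_and, Function.Embedding.coeFn_mk]
        exact ⟨⟨u.toNat, by omega⟩, by simp [h1]⟩
      simp [outI, this]
  have s1 : Summable (fun u => (outI n u : ℂ) * F u) := by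
    refine Summable.of_norm_bounded hF.norm fun u => ?_
    rw [norm_mul, Complex.norm_real, Real.norm_of_nonneg (outI_nonneg _ _)]
    exact mul_le_of_le_one_left (norm_nonneg _) (outI_le _ _)
  have s2 : Summable (fun u => (1 - (outI n u : ℂ)) * F u) := by
    refine (hF.sub s1).congr fun u => by ring
  rw [e, ← s1.tsum_add s2]
  exact tsum_congr fun u => by ring

lemma Err.step {A α : ℝ} {L c : ℕ → ℤ → ℂ} {M : ℕ → (n : ℕ) → Matrix (Fin n) (Fin n) ℂ}
    (hL : Dom A L) (hc : Dom α c) (hE : Err A L M) (hA : 0 ≤ A) (hα : 0 ≤ α) :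
    Err (A + α) (fun i => cv (L i) (c i)) (fun i n => M i n * Tp n (c i)) := by
  intro b S hb hS hS1
  set δ := (S - A - α - b) / 8 with hδ
  have hδ0 : 0 < δ := by rw [hδ]; linarith
  have hδS : S = A + α + b + 8 * δ := by rw [hδ]; ring
  obtain ⟨C1, hC1, h1⟩ := hL (A + δ) (by linarith) (by linarith)
  obtain ⟨C2, hC2, h2⟩ := hc (α + δ) (by linarith) (by linarith)
  obtain ⟨C3, hC3, h3⟩ := wt_conv_fin (a := α + δ) (b := b) (c := α + b + 2 * δ)
    (by linarith) hb (by linarith) (by linarith)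
  obtain ⟨C4, hC4, h4⟩ := out_sum (S := S) (S' := A + α + b + 3 * δ) (by linarith) hS1 (by linarith)
  obtain ⟨C5, hC5, h5⟩ := hE (α + b + 2 * δ) S (by linarith) (by linarith) hS1
  obtain ⟨C6, hC6, h6⟩ := wt_conv (a := A + δ) (b := α + δ) (c := 1) (by linarith)
    (by linarith) (by linarith) le_rfl
  refine ⟨C1 * C2 * C3 * C4 + C2 * C3 * C5, by positivity, fun i n => ?_⟩
  -- summability of products of weights
  have hsw : ∀ s t : ℤ, Summable (fun u => wt (A + δ) (s - u) * wt (α + δ) (u - t)) := by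
    intro s t
    refine ((Equiv.subLeft s).summable_iff.2 (h6 (s - t)).1).congr fun u => ?_
    simp
  have hLc : ∀ s t u : ℤ, ‖L i (s - u) * c i (u - t)‖ ≤
      C1 * C2 * (wt (A + δ) (s - u) * wt (α + δ) (u - t)) := by
    intro s t u
    rw [norm_mul]
    calc _ ≤ (C1 * wt (A + δ) (s - u)) * (C2 * wt (α + δ) (u - t)) :=
          mul_le_mul (h1 _ _) (h2 _ _) (norm_nonneg _) (mul_nonneg hC1 (wt_nonneg _ _))
      _ = _ := by ring
  have hso : ∀ s t : ℤ, Summable (fun u => C1 * C2 *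
      (outI n u * (wt (A + δ) (s - u) * wt (α + δ) (u - t)))) := by
    intro s t
    refine Summable.mul_left _ (Summable.of_nonneg_of_le (fun u => ?_) (fun u => ?_) (hsw s t))
    · exact mul_nonneg (outI_nonneg _ _) (mul_nonneg (wt_nonneg _ _) (wt_nonneg _ _))
    · exact mul_le_of_le_one_left (mul_nonneg (wt_nonneg _ _) (wt_nonneg _ _)) (outI_le _ _)
  -- pointwise bound
  have hpt : ∀ s t : Fin n, ‖cv (L i) (c i) (((s : ℕ) : ℤ) - ((t : ℕ) : ℤ))
        - (M i n * Tp n (c i)) s t‖ ≤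
      ∑' u : ℤ, C1 * C2 * (outI n u * (wt (A + δ) (((s : ℕ) : ℤ) - u) *
        wt (α + δ) (u - ((t : ℕ) : ℤ)))) +
      ∑ u : Fin n, C2 * (‖L i (((s : ℕ) : ℤ) - ((u : ℕ) : ℤ)) - M i n s u‖ *
        wt (α + δ) (((u : ℕ) : ℤ) - ((t : ℕ) : ℤ))) := by
    intro s t
    have e1 : cv (L i) (c i) (((s : ℕ) : ℤ) - ((t : ℕ) : ℤ)) =
        ∑' u : ℤ, L i (((s : ℕ) : ℤ) - u) * c i (u - ((t : ℕ) : ℤ)) := by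
      unfold cv
      rw [← (Equiv.subLeft ((s : ℕ) : ℤ)).tsum_eq]
      exact tsum_congr fun u => by simp
    have e2 : Summable (fun u : ℤ => L i (((s : ℕ) : ℤ) - u) * c i (u - ((t : ℕ) : ℤ))) :=
      Summable.of_norm_bounded ((hsw s t).mul_left (C1 * C2)) (hLc s t)
    rw [e1, tsum_split e2 n, add_sub_assoc, Matrix.mul_apply, ← Finset.sum_sub_distrib]
    refine (norm_add_le _ _).trans (add_le_add ?_ ?_)
    · refine tsum_of_norm_bounded (hso s t).hasSum fun u => ?_
      rw [norm_mul, Complex.norm_real, Real.norm_of_nonneg (outI_nonneg _ _), mul_left_comm]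
      exact mul_le_mul_of_nonneg_left (hLc _ _ _) (outI_nonneg _ _)
    · refine (norm_sum_le _ _).trans (Finset.sum_le_sum fun u _ => ?_)
      rw [show L i (((s : ℕ) : ℤ) - ((u : ℕ) : ℤ)) * c i (((u : ℕ) : ℤ) - ((t : ℕ) : ℤ)) -
        M i n s u * Tp n (c i) u t = (L i (((s : ℕ) : ℤ) - ((u : ℕ) : ℤ)) - M i n s u) *
          c i (((u : ℕ) : ℤ) - ((t : ℕ) : ℤ)) by unfold Tp; ring, norm_mul, mul_left_comm]
      exact mul_le_mul_of_nonneg_left (h2 _ _) (norm_nonneg _)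
  -- first part
  have hfirst : ∀ s : Fin n, ∑ t : Fin n, (∑' u : ℤ, C1 * C2 * (outI n u *
      (wt (A + δ) (((s : ℕ) : ℤ) - u) * wt (α + δ) (u - ((t : ℕ) : ℤ))))) *
        wt b (((t : ℕ) : ℤ) - ((s : ℕ) : ℤ)) ≤
      C1 * C2 * C3 * ∑' u : ℤ, outI n u * wt (A + α + b + 3 * δ - 1) (((s : ℕ) : ℤ) - u) := by
    intro s
    have ew : ∀ u : ℤ, wt (A + δ) (((s : ℕ) : ℤ) - u) * wt (α + b + 2 * δ) (u - ((s : ℕ) : ℤ)) =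
        wt (A + α + b + 3 * δ - 1) (((s : ℕ) : ℤ) - u) := by
      intro u
      rw [← wt_neg _ (u - _), neg_sub]
      unfold wt
      rw [← Real.rpow_add (by positivity)]
      ring_nf
    have hpu : ∀ u : ℤ, ∑ t : Fin n, C1 * C2 * (outI n u *
        (wt (A + δ) (((s : ℕ) : ℤ) - u) * wt (α + δ) (u - ((t : ℕ) : ℤ)))) *
        wt b (((t : ℕ) : ℤ) - ((s : ℕ) : ℤ)) ≤
        C1 * C2 * C3 * (outI n u * wt (A + α + b + 3 * δ - 1) (((s : ℕ) : ℤ) - u)) := by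
      intro u
      rw [← ew u]
      have p1 := outI_nonneg n u
      have p2 := wt_nonneg (A + δ) (((s : ℕ) : ℤ) - u)
      calc _ = C1 * C2 * (outI n u * wt (A + δ) (((s : ℕ) : ℤ) - u)) *
            ∑ t : Fin n, wt (α + δ) (u - ((t : ℕ) : ℤ)) *
              wt b (((t : ℕ) : ℤ) - ((s : ℕ) : ℤ)) := by
            rw [Finset.mul_sum]
            exact Finset.sum_congr rfl fun t _ => by ring
        _ ≤ C1 * C2 * (outI n u * wt (A + δ) (((s : ℕ) : ℤ) - u)) *
            (C3 * wt (α + b + 2 * δ) (u - ((s : ℕ) : ℤ))) := by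
            gcongr
            exact h3 n u s
        _ = _ := by ring
    have hsr : Summable (fun u : ℤ => C1 * C2 * C3 *
        (outI n u * wt (A + α + b + 3 * δ - 1) (((s : ℕ) : ℤ) - u))) := by
      have a1 : Summable (fun u => wt (A + α + b + 3 * δ - 1) (((s : ℕ) : ℤ) - u)) :=
        (Equiv.subLeft ((s : ℕ) : ℤ)).summable_iff.2 (wt_summable (by linarith))
      refine Summable.mul_left _ (Summable.of_nonneg_of_le (fun u => ?_) (fun u => ?_) a1)
      · exact mul_nonneg (outI_nonneg _ _) (wt_nonneg _ _)
      · exact mul_le_of_le_one_left (wt_nonneg _ _) (outI_le _ _)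
    have hsl := fun t : Fin n => (hso s t).mul_right (wt b (((t : ℕ) : ℤ) - ((s : ℕ) : ℤ)))
    rw [← tsum_mul_left]
    simp_rw [← tsum_mul_right]
    rw [← Summable.tsum_finsetSum (fun t _ => hsl t)]
    exact Summable.tsum_le_tsum hpu (summable_sum fun t _ => hsl t) hsr
  -- second part
  have hsecond : ∀ s : Fin n, ∑ t : Fin n, (∑ u : Fin n, C2 *
      (‖L i (((s : ℕ) : ℤ) - ((u : ℕ) : ℤ)) - M i n s u‖ *
        wt (α + δ) (((u : ℕ) : ℤ) - ((t : ℕ) : ℤ)))) * wt b (((t : ℕ) : ℤ) - ((s : ℕ) : ℤ)) ≤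
      C2 * C3 * ∑ u : Fin n, ‖L i (((s : ℕ) : ℤ) - ((u : ℕ) : ℤ)) - M i n s u‖ *
        wt (α + b + 2 * δ) (((u : ℕ) : ℤ) - ((s : ℕ) : ℤ)) := by
    intro s
    simp_rw [Finset.sum_mul]
    rw [Finset.sum_comm, Finset.mul_sum]
    refine Finset.sum_le_sum fun u _ => ?_
    calc _ = C2 * ‖L i (((s : ℕ) : ℤ) - ((u : ℕ) : ℤ)) - M i n s u‖ *
          ∑ t : Fin n, wt (α + δ) (((u : ℕ) : ℤ) - ((t : ℕ) : ℤ)) *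
            wt b (((t : ℕ) : ℤ) - ((s : ℕ) : ℤ)) := by
          rw [Finset.mul_sum]
          exact Finset.sum_congr rfl fun t _ => by ring
      _ ≤ C2 * ‖L i (((s : ℕ) : ℤ) - ((u : ℕ) : ℤ)) - M i n s u‖ *
            (C3 * wt (α + b + 2 * δ) (((u : ℕ) : ℤ) - ((s : ℕ) : ℤ))) := by
          gcongr
          exact h3 n u s
      _ = _ := by ring
  calc _ ≤ ∑ s : Fin n, ∑ t : Fin n, ((∑' u : ℤ, C1 * C2 * (outI n u *
          (wt (A + δ) (((s : ℕ) : ℤ) - u) * wt (α + δ) (u - ((t : ℕ) : ℤ))))) *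
          wt b (((t : ℕ) : ℤ) - ((s : ℕ) : ℤ)) +
        (∑ u : Fin n, C2 * (‖L i (((s : ℕ) : ℤ) - ((u : ℕ) : ℤ)) - M i n s u‖ *
        wt (α + δ) (((u : ℕ) : ℤ) - ((t : ℕ) : ℤ)))) *
          wt b (((t : ℕ) : ℤ) - ((s : ℕ) : ℤ))) := by
        refine Finset.sum_le_sum fun s _ => Finset.sum_le_sum fun t _ => ?_
        rw [← add_mul]
        exact mul_le_mul_of_nonneg_right (hpt s t) (wt_nonneg _ _)
    _ ≤ ∑ s : Fin n, (C1 * C2 * C3 * ∑' u : ℤ, outI n u *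
          wt (A + α + b + 3 * δ - 1) (((s : ℕ) : ℤ) - u) +
        C2 * C3 * ∑ u : Fin n, ‖L i (((s : ℕ) : ℤ) - ((u : ℕ) : ℤ)) - M i n s u‖ *
        wt (α + b + 2 * δ) (((u : ℕ) : ℤ) - ((s : ℕ) : ℤ))) := by
        refine Finset.sum_le_sum fun s _ => ?_
        rw [Finset.sum_add_distrib]
        exact add_le_add (hfirst s) (hsecond s)
    _ = C1 * C2 * C3 * ∑ s : Fin n, ∑' u : ℤ, outI n u *
          wt (A + α + b + 3 * δ - 1) (((s : ℕ) : ℤ) - u) +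
        C2 * C3 * ∑ s : Fin n, ∑ u : Fin n,
          ‖L i (((s : ℕ) : ℤ) - ((u : ℕ) : ℤ)) - M i n s u‖ *
        wt (α + b + 2 * δ) (((u : ℕ) : ℤ) - ((s : ℕ) : ℤ)) := by
        rw [Finset.sum_add_distrib, Finset.mul_sum, Finset.mul_sum]
    _ ≤ C1 * C2 * C3 * (C4 * (n : ℝ) ^ S) + C2 * C3 * (C5 * (n : ℝ) ^ S) := by
        gcongr
        · exact h4 n
        · exact h5 i n
    _ = _ := by ring

/-- Absolutely convergent Fourier representation. -/
def FRep (c : ℤ → ℂ) (G : ℝ → ℂ) : Prop :=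
  Summable (fun k => ‖c k‖) ∧
    ∀ x : ℝ, HasSum (fun k : ℤ => c k * Complex.exp (-(Complex.I * x * k))) (G x)

lemma norm_char (x : ℝ) (k : ℤ) : ‖Complex.exp (Complex.I * x * k)‖ = 1 := by
  have : Complex.I * x * k = ((x * k : ℝ) : ℂ) * Complex.I := by push_cast; ring
  rw [this, Complex.norm_exp_ofReal_mul_I]

lemma norm_char_neg (x : ℝ) (k : ℤ) : ‖Complex.exp (-(Complex.I * x * k))‖ = 1 := by
  have : -(Complex.I * x * k) = ((-(x * k) : ℝ) : ℂ) * Complex.I := by push_cast; ring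
  rw [this, Complex.norm_exp_ofReal_mul_I]

lemma mul_hs {f g : ℤ → ℂ} {a b : ℂ} (hf : Summable fun k => ‖f k‖)
    (hg : Summable fun k => ‖g k‖) (ha : HasSum f a) (hb : HasSum g b) :
    HasSum (fun q : ℤ × ℤ => f q.1 * g q.2) (a * b) :=
  ha.mul hb (summable_mul_of_summable_norm hf hg)

lemma FRep.mul {c c' : ℤ → ℂ} {G G' : ℝ → ℂ} (h : FRep c G) (h' : FRep c' G') :
    FRep (cv c c') (fun x => G x * G' x) := by
  let e : ℤ × ℤ ≃ ℤ × ℤ :=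
    { toFun := fun p => (p.2, p.1 - p.2)
      invFun := fun q => (q.1 + q.2, q.1)
      left_inv := fun p => by ext <;> simp
      right_inv := fun q => by ext <;> simp }
  have hN : Summable (fun p : ℤ × ℤ => ‖c p.2 * c' (p.1 - p.2)‖) := by
    have h0 : Summable (fun q : ℤ × ℤ => ‖c q.1 * c' q.2‖) := h.1.mul_norm h'.1
    exact (e.summable_iff.2 h0)
  have hf : ∀ k, Summable (fun j => ‖c j * c' (k - j)‖) := fun k => hN.prod_factor k
  have hP : Summable (fun k => ∑' j, ‖c j * c' (k - j)‖) := hN.prod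
  refine ⟨?_, fun x => ?_⟩
  · refine Summable.of_nonneg_of_le (fun _ => norm_nonneg _) (fun k => ?_) hP
    unfold cv
    exact norm_tsum_le_tsum_norm (hf k)
  · have s1 : Summable (fun k : ℤ => ‖c k * Complex.exp (-(Complex.I * x * k))‖) := by
      simpa only [norm_mul, norm_char_neg, mul_one] using h.1
    have s2 : Summable (fun k : ℤ => ‖c' k * Complex.exp (-(Complex.I * x * k))‖) := by
      simpa only [norm_mul, norm_char_neg, mul_one] using h'.1
    have h1 := mul_hs s1 s2 (h.2 x) (h'.2 x)
    have h2 := e.hasSum_iff.2 h1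
    refine h2.prod_fiberwise fun k => ?_
    have h3 : Summable (fun j => c j * c' (k - j)) := (hf k).of_norm
    have h4 := h3.hasSum.mul_right (Complex.exp (-(Complex.I * x * k)))
    refine h4.congr_fun ?_
    intro j
    simp only [e, Function.comp, Equiv.coe_fn_mk]
    rw [show -(Complex.I * x * k) = -(Complex.I * x * j) + -(Complex.I * x * ((k - j : ℤ) : ℂ)) by
      push_cast; ring, Complex.exp_add]
    ring

lemma FRep.neg {c : ℤ → ℂ} {G : ℝ → ℂ} (h : FRep c G) :
    FRep (fun k => c (-k)) (fun x => G (-x)) := by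
  refine ⟨(Equiv.neg ℤ).summable_iff.2 h.1, fun x => ?_⟩
  have := (Equiv.neg ℤ).hasSum_iff.2 (h.2 (-x))
  refine this.congr_fun ?_
  intro k
  simp

lemma rep_one : FRep (Pi.single 0 1) (fun _ => 1) := by
  constructor
  · refine (hasSum_single (f := fun k : ℤ => ‖(Pi.single 0 1 : ℤ → ℂ) k‖) 0 ?_).summable
    intro k hk
    simp [hk]
  · intro x
    have := hasSum_single (f := fun k : ℤ => (Pi.single 0 1 : ℤ → ℂ) k *
      Complex.exp (-(Complex.I * x * k))) 0 (by intro k hk; simp [hk])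
    simpa using this

lemma integral_char (k : ℤ) :
    ∫ x in Ioc (-π) π, Complex.exp (Complex.I * x * k) = if k = 0 then (2 * π : ℂ) else 0 := by
  rw [← intervalIntegral.integral_of_le (by linarith [Real.pi_pos])]
  split_ifs with h
  · subst h
    simp
    ring
  · have hk : Complex.I * k ≠ 0 := by simp [h]
    have := integral_exp_mul_complex (a := -π) (b := π) hk
    simp_rw [mul_right_comm Complex.I _ (k : ℂ)]
    rw [this]
    have e : Complex.exp (Complex.I * k * π) = Complex.exp (Complex.I * k * ((-π : ℝ) : ℂ)) := by
      rw [Complex.exp_eq_exp_iff_exists_int]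
      exact ⟨k, by push_cast; ring⟩
    rw [e, sub_self, zero_div]

lemma FRep.coef {c : ℤ → ℂ} {G : ℝ → ℂ} (h : FRep c G) (t : ℤ) :
    ∫ x in Ioc (-π) π, Complex.exp (Complex.I * x * t) * G x = 2 * π * c t := by
  have hF : ∀ k : ℤ, Integrable (fun x : ℝ => Complex.exp (Complex.I * x * t) *
      (c k * Complex.exp (-(Complex.I * x * k)))) (volume.restrict (Ioc (-π) π)) := by
    intro k
    have : Continuous (fun x : ℝ => Complex.exp (Complex.I * x * t) *
      (c k * Complex.exp (-(Complex.I * x * k)))) := by fun_prop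
    exact (this.integrableOn_Icc).mono_set Ioc_subset_Icc_self
  have hn : ∀ (k : ℤ) (x : ℝ), ‖Complex.exp (Complex.I * x * t) *
      (c k * Complex.exp (-(Complex.I * x * k)))‖ = ‖c k‖ := by
    intro k x
    rw [norm_mul, norm_mul, norm_char, norm_char_neg]; ring
  have := hasSum_integral_of_summable_integral_norm hF (by
    simp_rw [hn]
    simp only [integral_const]
    exact h.1.mul_left _)
  have e1 : ∀ x : ℝ, ∑' k : ℤ, Complex.exp (Complex.I * x * t) *
      (c k * Complex.exp (-(Complex.I * x * k))) = Complex.exp (Complex.I * x * t) * G x := by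
    intro x
    exact ((h.2 x).mul_left _).tsum_eq
  have e2 : ∀ k : ℤ, ∫ x in Ioc (-π) π, Complex.exp (Complex.I * x * t) *
      (c k * Complex.exp (-(Complex.I * x * k))) = if k = t then 2 * π * c t else 0 := by
    intro k
    have : ∀ x : ℝ, Complex.exp (Complex.I * x * t) * (c k * Complex.exp (-(Complex.I * x * k)))
        = c k * Complex.exp (Complex.I * x * ((t - k : ℤ) : ℂ)) := by
      intro x
      rw [show Complex.I * x * ((t - k : ℤ) : ℂ) = Complex.I * x * t + -(Complex.I * x * k) by
        push_cast; ring, Complex.exp_add]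
      ring
    simp_rw [this]
    rw [integral_const_mul, integral_char]
    by_cases hk : k = t
    · subst hk; simp; ring
    · have : t - k ≠ 0 := by omega
      simp [hk, this]
  simp_rw [e1, e2] at this
  exact this.unique (by simpa using hasSum_ite_eq t (2 * π * c t))

lemma psi_succ (a : ℂ) (n : ℕ) :
    ((n : ℂ) + 1) * Ring.multichoose a (n + 1) = (a + n) * Ring.multichoose a n := by
  have h1 := Ring.factorial_nsmul_multichoose_eq_ascPochhammer a (n + 1)
  have h0 := Ring.factorial_nsmul_multichoose_eq_ascPochhammer a n
  rw [Polynomial.ascPochhammer_smeval_eq_eval, nsmul_eq_mul] at h1 h0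
  rw [ascPochhammer_succ_eval, ← h0, Nat.factorial_succ] at h1
  have hf : ((n.factorial : ℕ) : ℂ) ≠ 0 := by exact_mod_cast Nat.factorial_ne_zero n
  push_cast at h1
  apply mul_left_cancel₀ hf
  linear_combination h1

lemma psi_bound {d : ℝ} (hd0 : 0 < d) (hd1 : d < 1) (n : ℕ) :
    ‖Ring.multichoose (d : ℂ) n‖ ≤ (1 + (n : ℝ)) ^ (d - 1) := by
  induction n with
  | zero => simp
  | succ n ih =>
    have h := congrArg norm (psi_succ d n)
    rw [norm_mul, norm_mul] at h
    have e1 : ‖(n : ℂ) + 1‖ = 1 + n := by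
      rw [show (n : ℂ) + 1 = ((1 + n : ℝ) : ℂ) by push_cast; ring, Complex.norm_real,
        Real.norm_of_nonneg (by positivity)]
    have e2 : ‖(d : ℂ) + n‖ = d + n := by
      rw [show (d : ℂ) + n = ((d + n : ℝ) : ℂ) by push_cast; ring, Complex.norm_real,
        Real.norm_of_nonneg (by positivity)]
    rw [e1, e2] at h
    have hn : (0 : ℝ) < 1 + n := by positivity
    have hn2 : (0 : ℝ) < 2 + n := by positivity
    -- Bernoulli
    have hb := rpow_one_add_le_one_add_mul_self (s := (1 + (n : ℝ))⁻¹) (p := 1 - d)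
      (by have : 0 < (1 + (n : ℝ))⁻¹ := by positivity
          linarith) (by linarith) (by linarith)
    have e3 : 1 + (1 + (n : ℝ))⁻¹ = (2 + n) / (1 + n) := by field_simp; ring
    rw [e3, Real.div_rpow hn2.le hn.le, div_le_iff₀ (by positivity)] at hb
    push_cast
    rw [show 1 + ((n : ℝ) + 1) = 2 + n by ring, show d - 1 = -(1 - d) by ring,
      Real.rpow_neg hn2.le]
    rw [show d - 1 = -(1 - d) by ring, Real.rpow_neg hn.le] at ih
    set X := (1 + (n : ℝ)) ^ (1 - d) with hX
    set Y := (2 + (n : ℝ)) ^ (1 - d) with hY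
    have hX0 : 0 < X := by positivity
    have hY0 : 0 < Y := by positivity
    have h3 : ‖Ring.multichoose (d : ℂ) (n + 1)‖ ≤ (d + n) * X⁻¹ / (1 + n) := by
      rw [le_div_iff₀ hn, mul_comm, h]
      gcongr
    refine h3.trans ?_
    rw [← div_eq_mul_inv, div_div, inv_eq_one_div, div_le_div_iff₀ (by positivity) hY0, one_mul]
    -- (d+n) Y ≤ X (1+n)
    have h4 : (d + n) * Y ≤ (d + n) * ((1 + (1 - d) * (1 + (n : ℝ))⁻¹) * X) := by gcongr
    refine h4.trans ?_
    have h5 : (d + n) * (1 + (1 - d) * (1 + (n : ℝ))⁻¹) ≤ 1 + n := by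
      have : (d + n) * (1 + (1 - d) * (1 + (n : ℝ))⁻¹) = (d + n) * (2 + n - d) / (1 + n) := by
        field_simp; ring
      rw [this, div_le_iff₀ hn]
      nlinarith [sq_nonneg (1 - d)]
    nlinarith

/-- Coefficients of the power series of `(1 - ρ z)^(-d)`. -/
def pc (d ρ : ℝ) (k : ℤ) : ℂ :=
  if 0 ≤ k then Ring.multichoose (d : ℂ) k.toNat * (ρ : ℂ) ^ k.toNat else 0

lemma pc_bound {d ρ : ℝ} (hd0 : 0 < d) (hd1 : d < 1) (hρ : 0 ≤ ρ) (hρ1 : ρ < 1) (k : ℤ) :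
    ‖pc d ρ k‖ ≤ wt d k := by
  unfold pc
  split_ifs with h
  · lift k to ℕ using h
    rw [norm_mul, norm_pow, Complex.norm_real, Real.norm_of_nonneg hρ]
    have := psi_bound hd0 hd1 k
    simp only [Int.toNat_natCast]
    calc _ ≤ ‖Ring.multichoose (d : ℂ) k‖ * 1 := by
          gcongr
          exact pow_le_one₀ hρ hρ1.le
      _ ≤ _ := by simpa [wt] using this
  · simpa using wt_nonneg d k

lemma pc_rep {d ρ : ℝ} (hd0 : 0 < d) (hd1 : d < 1) (hρ : 0 ≤ ρ) (hρ1 : ρ < 1) :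
    FRep (pc d ρ) (fun x => 1 / (1 - ρ * Complex.exp (-(Complex.I * x))) ^ (d : ℂ)) := by
  have hi : Function.Injective (Nat.cast : ℕ → ℤ) := Nat.cast_injective
  have hr : ∀ k : ℤ, k ∉ Set.range (Nat.cast : ℕ → ℤ) → pc d ρ k = 0 := by
    intro k hk
    unfold pc
    rw [if_neg]
    intro h0
    exact hk ⟨k.toNat, by simp [h0]⟩
  constructor
  · rw [← hi.summable_iff (by intro k hk; simp [hr k hk])]
    refine Summable.of_nonneg_of_le (fun _ => norm_nonneg _) (fun n => ?_)
      (summable_geometric_of_lt_one hρ hρ1)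
    simp only [Function.comp, pc, Int.natCast_nonneg, if_true, Int.toNat_natCast]
    rw [norm_mul, norm_pow, Complex.norm_real, Real.norm_of_nonneg hρ]
    refine mul_le_of_le_one_left (by positivity) ((psi_bound hd0 hd1 n).trans ?_)
    exact Real.rpow_le_one_of_one_le_of_nonpos (by linarith [Nat.cast_nonneg (α := ℝ) n])
      (by linarith)
  · intro x
    rw [← hi.hasSum_iff (by intro k hk; simp [hr k hk])]
    have hy : ‖(ρ : ℂ) * Complex.exp (-(Complex.I * x))‖ < 1 := by
      have := norm_char_neg x 1
      simp only [Int.cast_one, mul_one] at this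
      rw [norm_mul, this, Complex.norm_real, Real.norm_of_nonneg hρ]
      linarith
    have := (Complex.one_div_one_sub_cpow_hasFPowerSeriesOnBall_zero (d : ℂ)).hasSum
      (y := (ρ : ℂ) * Complex.exp (-(Complex.I * x))) (by
        rw [← ENNReal.ofReal_one, Metric.eball_ofReal]
        simpa using hy)
    rw [zero_add] at this
    refine this.congr_fun ?_
    intro n
    simp only [Function.comp, pc, Int.natCast_nonneg, if_true, Int.toNat_natCast]
    rw [FormalMultilinearSeries.ofScalars_apply_eq, ← Ring.multichoose_eq, mul_pow,
      ← Complex.exp_nat_mul, smul_eq_mul]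
    push_cast
    rw [show (n : ℂ) * -(Complex.I * x) = -(Complex.I * x * n) by ring]
    ring

/-- The regularised spectral density. -/
def Gr (d ρ x : ℝ) : ℝ := ‖1 - (ρ : ℂ) * Complex.exp (Complex.I * x)‖ ^ (-(2 * d))

lemma Gr_eq {d ρ : ℝ} (hρ : 0 ≤ ρ) (hρ1 : ρ < 1) (x : ℝ) :
    1 / (1 - ρ * Complex.exp (-(Complex.I * x))) ^ (d : ℂ) *
      (1 / (1 - ρ * Complex.exp (-(Complex.I * (-x : ℝ)))) ^ (d : ℂ)) = (Gr d ρ x : ℂ) := by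
  set z := 1 - (ρ : ℂ) * Complex.exp (-(Complex.I * (-x : ℝ))) with hz
  have hz' : 1 - (ρ : ℂ) * Complex.exp (Complex.I * x) = z := by rw [hz]; push_cast; ring_nf
  have hc : 1 - ρ * Complex.exp (-(Complex.I * x)) = (starRingEnd ℂ) z := by
    rw [← hz', map_sub, map_mul, ← Complex.exp_conj, map_mul]
    simp
  have hs : z ∈ Complex.slitPlane := by
    rw [← hz', sub_eq_add_neg]
    apply Complex.mem_slitPlane_of_norm_lt_one
    have := norm_char x 1
    simp only [Int.cast_one, mul_one] at this
    rw [norm_neg, norm_mul, this, Complex.norm_real, Real.norm_of_nonneg hρ]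
    linarith
  have hz0 : z ≠ 0 := Complex.slitPlane_ne_zero hs
  have harg : z.arg ≠ π := (Complex.mem_slitPlane_iff_arg.1 hs).1
  have e : (starRingEnd ℂ) z ^ (d : ℂ) = (starRingEnd ℂ) (z ^ (d : ℂ)) := by
    have := Complex.conj_cpow z (d : ℂ) harg
    simpa using this
  rw [hc, e, div_mul_div_comm, one_mul, mul_comm, Complex.mul_conj, Complex.normSq_eq_norm_sq,
    Complex.norm_cpow_real]
  unfold Gr
  rw [hz', Real.rpow_neg (norm_nonneg _), two_mul, Real.rpow_add (norm_pos_iff.2 hz0)]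
  push_cast
  rw [sq, one_div]

lemma integrable_abs_rpow {s : ℝ} (hs : s < 1) :
    IntegrableOn (fun x : ℝ => |x| ^ (-s)) (Ioc (-π) π) := by
  have h1 : IntervalIntegrable (fun x : ℝ => |x| ^ (-s)) volume 0 π := by
    refine (intervalIntegral.intervalIntegrable_rpow' (a := 0) (b := π)
      (show -1 < -s by linarith)).congr ?_
    intro x hx
    rw [uIoc_of_le Real.pi_pos.le] at hx
    simp only
    rw [abs_of_pos hx.1]
  have h2 : IntervalIntegrable (fun x : ℝ => |x| ^ (-s)) volume (-π) 0 := by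
    have := (h1.comp_sub_left 0).symm
    simpa using this
  rw [← intervalIntegrable_iff_integrableOn_Ioc_of_le (by linarith [Real.pi_pos])]
  exact h2.trans h1

lemma ae_ne_zero : ∀ᵐ x : ℝ ∂(volume.restrict (Ioc (-π) π)), x ∈ Ioc (-π) π ∧ x ≠ 0 := by
  have h1 : ∀ᵐ x : ℝ ∂(volume.restrict (Ioc (-π) π)), x ∈ Ioc (-π) π :=
    ae_restrict_mem measurableSet_Ioc
  have h2 : ∀ᵐ x : ℝ ∂(volume.restrict (Ioc (-π) π)), x ≠ 0 :=
    ae_restrict_of_ae (by simp [ae_iff])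
  filter_upwards [h1, h2] with x a b using ⟨a, b⟩

lemma dct {H : ℕ → ℝ → ℂ} {H' : ℝ → ℂ} {K s : ℝ} (hs : s < 1) (hm : ∀ i, Measurable (H i))
    (hb : ∀ i, ∀ x ∈ Ioc (-π) π, x ≠ 0 → ‖H i x‖ ≤ K * |x| ^ (-s))
    (hl : ∀ x ∈ Ioc (-π) π, x ≠ 0 → Tendsto (fun i => H i x) atTop (𝓝 (H' x))) :
    Tendsto (fun i => ∫ x in Ioc (-π) π, H i x) atTop (𝓝 (∫ x in Ioc (-π) π, H' x)) := by
  refine tendsto_integral_of_dominated_convergence (fun x => K * |x| ^ (-s))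
    (fun i => (hm i).aestronglyMeasurable) ((integrable_abs_rpow hs).const_mul K) (fun i => ?_) ?_
  · filter_upwards [ae_ne_zero] with x hx using hb i x hx.1 hx.2
  · filter_upwards [ae_ne_zero] with x hx using hl x hx.1 hx.2

lemma norm_one_sub_lower {x : ℝ} (hx : x ∈ Ioc (-π) π) :
    2 / π * |x| ≤ ‖1 - Complex.exp (Complex.I * x)‖ := by
  rw [norm_sub_rev, Complex.norm_exp_I_mul_ofReal_sub_one, norm_mul, Real.norm_eq_abs,
    Real.norm_eq_abs, abs_of_pos (by norm_num : (0 : ℝ) < 2)]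
  have h1 : |x / 2| ≤ π / 2 := by
    rw [abs_le]; constructor <;> linarith [hx.1, hx.2]
  have := Real.mul_abs_le_abs_sin h1
  rw [abs_div, abs_of_pos (by norm_num : (0 : ℝ) < 2)] at this
  linarith

lemma norm_one_sub_rho {ρ : ℝ} (hρ : 0 ≤ ρ) (hρ1 : ρ ≤ 1) (x : ℝ) :
    ‖1 - Complex.exp (Complex.I * x)‖ ≤ 2 * ‖1 - (ρ : ℂ) * Complex.exp (Complex.I * x)‖ := by
  have hn : ‖Complex.exp (Complex.I * x)‖ = 1 := by simpa using norm_char x 1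
  have h1 : 1 - ρ ≤ ‖1 - (ρ : ℂ) * Complex.exp (Complex.I * x)‖ := by
    have := norm_sub_norm_le (1 : ℂ) ((ρ : ℂ) * Complex.exp (Complex.I * x))
    rw [norm_mul, hn, Complex.norm_real, Real.norm_of_nonneg hρ, norm_one, mul_one] at this
    exact this
  have h2 : 1 - Complex.exp (Complex.I * x) = (1 - (ρ : ℂ) * Complex.exp (Complex.I * x)) +
      ((ρ - 1 : ℝ) : ℂ) * Complex.exp (Complex.I * x) := by push_cast; ring
  have h3 : ‖((ρ - 1 : ℝ) : ℂ) * Complex.exp (Complex.I * x)‖ = 1 - ρ := by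
    rw [norm_mul, hn, Complex.norm_real, Real.norm_of_nonpos (by linarith)]; ring
  rw [h2]
  refine (norm_add_le _ _).trans ?_
  rw [h3]
  linarith

lemma Gr_nonneg (d ρ x : ℝ) : 0 ≤ Gr d ρ x := by unfold Gr; positivity

lemma Gr_bound {d ρ x : ℝ} (hd : 0 < d) (hρ : 0 ≤ ρ) (hρ1 : ρ ≤ 1) (hx : x ∈ Ioc (-π) π)
    (hx0 : x ≠ 0) : Gr d ρ x ≤ π ^ (2 * d) * |x| ^ (-(2 * d)) := by
  have h1 := norm_one_sub_lower hx
  have h2 := norm_one_sub_rho hρ hρ1 x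
  have hx1 : 0 < |x| := abs_pos.2 hx0
  have hp := Real.pi_pos
  have h3 : |x| / π ≤ ‖1 - (ρ : ℂ) * Complex.exp (Complex.I * x)‖ := by
    have : 2 / π * |x| = 2 * (|x| / π) := by ring
    linarith
  unfold Gr
  calc _ ≤ (|x| / π) ^ (-(2 * d)) :=
        Real.rpow_le_rpow_of_nonpos (by positivity) h3 (by linarith)
    _ = _ := by
        rw [Real.div_rpow hx1.le hp.le, Real.rpow_neg hp.le, div_inv_eq_mul, mul_comm]

lemma Gr_meas (d ρ : ℝ) : Measurable (Gr d ρ) := by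
  unfold Gr
  apply Measurable.pow_const
  apply Continuous.measurable
  fun_prop

/-- A sequence of radii increasing to one. -/
def rr (i : ℕ) : ℝ := 1 - 1 / ((i : ℝ) + 1)

lemma rr_nonneg (i : ℕ) : 0 ≤ rr i := by
  unfold rr
  have : 1 / ((i : ℝ) + 1) ≤ 1 := by
    rw [div_le_one (by positivity)]; linarith [Nat.cast_nonneg (α := ℝ) i]
  linarith

lemma rr_lt (i : ℕ) : rr i < 1 := by
  unfold rr
  have : 0 < 1 / ((i : ℝ) + 1) := by positivity
  linarith

lemma rr_tendsto : Tendsto rr atTop (𝓝 1) := by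
  have := (tendsto_const_nhds (x := (1 : ℝ))).sub (tendsto_one_div_add_atTop_nhds_zero_nat (𝕜 := ℝ))
  have e : rr = fun i : ℕ => 1 - 1 / ((i : ℝ) + 1) := rfl
  rw [e]
  simpa using this

lemma Gr_tendsto (d : ℝ) {x : ℝ} (hx : x ∈ Ioc (-π) π) (hx0 : x ≠ 0) :
    Tendsto (fun i => Gr d (rr i) x) atTop (𝓝 (Gr d 1 x)) := by
  have h0 : ‖1 - ((1 : ℝ) : ℂ) * Complex.exp (Complex.I * x)‖ ≠ 0 := by
    have := norm_one_sub_lower hx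
    have h2 : 0 < 2 / π * |x| := by
      have := abs_pos.2 hx0
      have := Real.pi_pos
      positivity
    simp only [Complex.ofReal_one, one_mul]
    linarith
  have hc : Tendsto (fun ρ : ℝ => ‖1 - (ρ : ℂ) * Complex.exp (Complex.I * x)‖) (𝓝 1)
      (𝓝 ‖1 - ((1 : ℝ) : ℂ) * Complex.exp (Complex.I * x)‖) := by
    apply Continuous.tendsto
    fun_prop
  exact (hc.rpow_const (p := -(2 * d)) (Or.inl h0)).comp rr_tendsto

/-- Fourier coefficients of the regularised densities. -/
def cc (d : ℝ) (i : ℕ) : ℤ → ℂ := cv (pc d (rr i)) (fun k => pc d (rr i) (-k))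

/-- Fourier coefficients of the limit density. -/
def cl (d : ℝ) (t : ℤ) : ℂ :=
  (2 * π : ℂ)⁻¹ * ∫ x in Ioc (-π) π, Complex.exp (Complex.I * x * t) * (Gr d 1 x : ℂ)

lemma cc_rep {d : ℝ} (hd0 : 0 < d) (hd1 : d < 1 / 2) (i : ℕ) :
    FRep (cc d i) (fun x => (Gr d (rr i) x : ℂ)) := by
  have h := pc_rep (d := d) hd0 (by linarith) (rr_nonneg i) (rr_lt i)
  have h2 := h.mul h.neg
  simp only [Gr_eq (rr_nonneg i) (rr_lt i)] at h2
  exact h2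

lemma cc_dom {d : ℝ} (hd0 : 0 < d) (hd1 : d < 1 / 2) : Dom (2 * d) (cc d) := by
  have h1 : Dom d (fun i => pc d (rr i)) := by
    intro A' hA' _
    refine ⟨1, zero_le_one, fun i k => ?_⟩
    rw [one_mul]
    exact (pc_bound hd0 (by linarith) (rr_nonneg i) (rr_lt i) k).trans (wt_mono hA'.le k)
  have h2 : Dom d (fun i k => pc d (rr i) (-k)) := by
    intro A' hA' _
    refine ⟨1, zero_le_one, fun i k => ?_⟩
    rw [one_mul, ← wt_neg A' k]
    exact (pc_bound hd0 (by linarith) (rr_nonneg i) (rr_lt i) (-k)).trans (wt_mono hA'.le (-k))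
  have := h1.cv h2 hd0.le hd0.le
  rw [two_mul]
  exact this

lemma two_pi_ne : (2 * π : ℂ) ≠ 0 := by
  have : (π : ℂ) ≠ 0 := by exact_mod_cast Real.pi_ne_zero
  simp [this]

lemma cc_tendsto {d : ℝ} (hd0 : 0 < d) (hd1 : d < 1 / 2) (t : ℤ) :
    Tendsto (fun i => cc d i t) atTop (𝓝 (cl d t)) := by
  have e : ∀ i, cc d i t = (2 * π : ℂ)⁻¹ *
      ∫ x in Ioc (-π) π, Complex.exp (Complex.I * x * t) * (Gr d (rr i) x : ℂ) := by
    intro i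
    rw [(cc_rep hd0 hd1 i).coef t, inv_mul_cancel_left₀ two_pi_ne]
  simp_rw [e]
  refine Tendsto.const_mul _ ?_
  refine dct (K := π ^ (2 * d)) (s := 2 * d) (by linarith) (fun i => ?_) (fun i x hx hx0 => ?_)
    (fun x hx hx0 => ?_)
  · have h1 : Measurable (fun x : ℝ => Complex.exp (Complex.I * x * t)) := by
      apply Continuous.measurable; fun_prop
    exact h1.mul (Complex.measurable_ofReal.comp (Gr_meas d (rr i)))
  · rw [norm_mul, norm_char, one_mul, Complex.norm_real, Real.norm_of_nonneg (Gr_nonneg _ _ _)]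
    exact Gr_bound hd0 (rr_nonneg i) (rr_lt i).le hx hx0
  · exact ((Complex.continuous_ofReal.tendsto _).comp (Gr_tendsto d hx hx0)).const_mul _

/-- Iterated convolutions. -/
def LL (d0 d1 : ℝ) : ℕ → ℕ → ℤ → ℂ
  | 0, _ => Pi.single 0 1
  | l + 1, i => cv (cv (LL d0 d1 l i) (cc d0 i)) (cc d1 i)

lemma LL_main {d0 d1 : ℝ} (h0 : 0 < d0) (h0' : d0 < 1 / 2) (h1 : 0 < d1) (h1' : d1 < 1 / 2)
    (l : ℕ) :
    Dom (2 * l * (d0 + d1)) (LL d0 d1 l) ∧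
    Err (2 * l * (d0 + d1)) (LL d0 d1 l)
      (fun i n => (Tp n (cc d0 i) * Tp n (cc d1 i)) ^ l) ∧
    ∀ i, FRep (LL d0 d1 l i) (fun x => (((Gr d0 (rr i) x * Gr d1 (rr i) x) ^ l : ℝ) : ℂ)) := by
  induction l with
  | zero =>
    refine ⟨?_, ?_, fun i => ?_⟩
    · intro A' _ _
      refine ⟨1, zero_le_one, fun i k => ?_⟩
      rw [one_mul]
      by_cases hk : k = 0
      · subst hk; simp [LL, wt]
      · simpa [LL, hk] using wt_nonneg A' k
    · intro b S _ _ _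
      refine ⟨0, le_rfl, fun i n => ?_⟩
      rw [zero_mul]
      refine (Finset.sum_eq_zero fun s _ => Finset.sum_eq_zero fun t _ => ?_).le
      have : LL d0 d1 0 i (((s : ℕ) : ℤ) - ((t : ℕ) : ℤ)) -
          ((Tp n (cc d0 i) * Tp n (cc d1 i)) ^ 0) s t = 0 := by
        rw [pow_zero, Matrix.one_apply]
        by_cases hst : s = t
        · subst hst; simp [LL]
        · have : ((s : ℕ) : ℤ) - ((t : ℕ) : ℤ) ≠ 0 := by
            intro h
            apply hst
            ext
            omega
          simp [LL, hst, this]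
      rw [this, norm_zero, zero_mul]
    · simpa [LL] using rep_one
  | succ l ih =>
    obtain ⟨iD, iE, iR⟩ := ih
    have p0 : 0 ≤ 2 * (l : ℝ) * (d0 + d1) := by positivity
    have p1 : 0 ≤ 2 * (l : ℝ) * (d0 + d1) + 2 * d0 := by positivity
    have e : 2 * ((l + 1 : ℕ) : ℝ) * (d0 + d1) = 2 * (l : ℝ) * (d0 + d1) + 2 * d0 + 2 * d1 := by
      push_cast; ring
    have D1 := iD.cv (cc_dom h0 h0') p0 (by linarith)
    have D2 := D1.cv (cc_dom h1 h1') p1 (by linarith)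
    have E1 := Err.step iD (cc_dom h0 h0') iE p0 (by linarith)
    have E2 := Err.step D1 (cc_dom h1 h1') E1 p1 (by linarith)
    rw [e]
    refine ⟨D2, ?_, fun i => ?_⟩
    · simp_rw [pow_succ, ← Matrix.mul_assoc]
      exact E2
    · have := ((iR i).mul (cc_rep h0 h0' i)).mul (cc_rep h1 h1' i)
      have e2 : ∀ x : ℝ, (((Gr d0 (rr i) x * Gr d1 (rr i) x) ^ (l + 1) : ℝ) : ℂ) =
          (((Gr d0 (rr i) x * Gr d1 (rr i) x) ^ l : ℝ) : ℂ) * (Gr d0 (rr i) x : ℂ) *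
            (Gr d1 (rr i) x : ℂ) := by
        intro x; push_cast; ring
      simp_rw [e2]
      exact this

lemma LL_tendsto {d0 d1 : ℝ} (h0 : 0 < d0) (h0' : d0 < 1 / 2) (h1 : 0 < d1) (h1' : d1 < 1 / 2)
    (ν : ℕ) (hν : 2 * ν * (d0 + d1) < 1) :
    Tendsto (fun i => LL d0 d1 ν i 0) atTop (𝓝 ((2 * π : ℂ)⁻¹ *
      ∫ x in Ioc (-π) π, (((Gr d0 1 x * Gr d1 1 x) ^ ν : ℝ) : ℂ))) := by
  have e : ∀ i, LL d0 d1 ν i 0 = (2 * π : ℂ)⁻¹ *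
      ∫ x in Ioc (-π) π, (((Gr d0 (rr i) x * Gr d1 (rr i) x) ^ ν : ℝ) : ℂ) := by
    intro i
    have := ((LL_main h0 h0' h1 h1' ν).2.2 i).coef 0
    simp only [Int.cast_zero, mul_zero, Complex.exp_zero, one_mul] at this
    rw [this, inv_mul_cancel_left₀ two_pi_ne]
  simp_rw [e]
  refine Tendsto.const_mul _ ?_
  refine dct (K := (π ^ (2 * d0) * π ^ (2 * d1)) ^ ν) (s := 2 * ν * (d0 + d1)) hν (fun i => ?_)
    (fun i x hx hx0 => ?_) (fun x hx hx0 => ?_)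
  · exact Complex.measurable_ofReal.comp (((Gr_meas _ _).mul (Gr_meas _ _)).pow_const ν)
  · have g0 := Gr_nonneg d0 (rr i) x
    have g1 := Gr_nonneg d1 (rr i) x
    rw [Complex.norm_real, Real.norm_of_nonneg (by positivity)]
    have hx1 : 0 < |x| := abs_pos.2 hx0
    have b0 := Gr_bound h0 (rr_nonneg i) (rr_lt i).le hx hx0
    have b1 := Gr_bound h1 (rr_nonneg i) (rr_lt i).le hx hx0
    have hp := Real.pi_pos
    have ex : |x| ^ (-(2 * ν * (d0 + d1))) = (|x| ^ (-(2 * d0)) * |x| ^ (-(2 * d1))) ^ ν := by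
      rw [← Real.rpow_add hx1, ← Real.rpow_natCast, ← Real.rpow_mul hx1.le]
      ring_nf
    rw [ex, ← mul_pow]
    refine pow_le_pow_left₀ (by positivity) ?_ ν
    calc _ ≤ (π ^ (2 * d0) * |x| ^ (-(2 * d0))) * (π ^ (2 * d1) * |x| ^ (-(2 * d1))) := by gcongr
      _ = _ := by ring
  · exact (Complex.continuous_ofReal.tendsto _).comp
      (((Gr_tendsto d0 hx hx0).mul (Gr_tendsto d1 hx hx0)).pow ν)

lemma bound_limit {d0 d1 : ℝ} (h0 : 0 < d0) (h0' : d0 < 1 / 2) (h1 : 0 < d1) (h1' : d1 < 1 / 2)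
    (ν : ℕ) {S : ℝ} (hS : 2 * ν * (d0 + d1) < S) (hS1 : S ≤ 1) :
    ∃ C, 0 ≤ C ∧ ∀ n : ℕ, 0 < n →
      ‖(n : ℂ)⁻¹ * Matrix.trace ((Tp n (cl d0) * Tp n (cl d1)) ^ ν) - (2 * π : ℂ)⁻¹ *
        ∫ x in Ioc (-π) π, (((Gr d0 1 x * Gr d1 1 x) ^ ν : ℝ) : ℂ)‖ ≤ C * (n : ℝ) ^ (S - 1) := by
  obtain ⟨C, hC, h⟩ := (LL_main h0 h0' h1 h1' ν).2.1 0 S le_rfl (by linarith) hS1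
  refine ⟨C, hC, fun n hn => ?_⟩
  have hn0 : (0 : ℝ) < n := by exact_mod_cast hn
  have hT : ∀ d : ℝ, 0 < d → d < 1 / 2 →
      Tendsto (fun i => Tp n (cc d i)) atTop (𝓝 (Tp n (cl d))) := by
    intro d hd hd'
    refine tendsto_pi_nhds.2 fun s => tendsto_pi_nhds.2 fun t => ?_
    exact cc_tendsto hd hd' _
  have hM : Tendsto (fun i => Matrix.trace ((Tp n (cc d0 i) * Tp n (cc d1 i)) ^ ν)) atTop
      (𝓝 (Matrix.trace ((Tp n (cl d0) * Tp n (cl d1)) ^ ν))) := by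
    have hc : Continuous (fun A : Matrix (Fin n) (Fin n) ℂ => A.trace) := continuous_id.matrix_trace
    exact (hc.tendsto _).comp (((hT d0 h0 h0').mul (hT d1 h1 h1')).pow ν)
  have hlim := ((hM.const_mul (n : ℂ)⁻¹).sub
    (LL_tendsto h0 h0' h1 h1' ν (by linarith))).norm
  refine le_of_tendsto hlim (Eventually.of_forall fun i => ?_)
  have key : (n : ℂ)⁻¹ * Matrix.trace ((Tp n (cc d0 i) * Tp n (cc d1 i)) ^ ν) - LL d0 d1 ν i 0 =
      -((n : ℂ)⁻¹ * ∑ s : Fin n, (LL d0 d1 ν i (((s : ℕ) : ℤ) - ((s : ℕ) : ℤ)) -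
        ((Tp n (cc d0 i) * Tp n (cc d1 i)) ^ ν) s s)) := by
    have hnc : (n : ℂ) ≠ 0 := by exact_mod_cast hn.ne'
    simp only [sub_self, Finset.sum_sub_distrib, Finset.sum_const, Finset.card_univ,
      Fintype.card_fin, nsmul_eq_mul, Matrix.trace, Matrix.diag]
    field_simp
    ring
  rw [key, norm_neg, norm_mul, norm_inv, Complex.norm_natCast]
  have hb : ‖∑ s : Fin n, (LL d0 d1 ν i (((s : ℕ) : ℤ) - ((s : ℕ) : ℤ)) -
        ((Tp n (cc d0 i) * Tp n (cc d1 i)) ^ ν) s s)‖ ≤ C * (n : ℝ) ^ S := by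
    refine (norm_sum_le _ _).trans (le_trans (Finset.sum_le_sum fun s _ => ?_) (h i n))
    have := Finset.single_le_sum (s := Finset.univ) (f := fun t : Fin n =>
      ‖LL d0 d1 ν i (((s : ℕ) : ℤ) - ((t : ℕ) : ℤ)) -
        ((Tp n (cc d0 i) * Tp n (cc d1 i)) ^ ν) s t‖ * wt 0 (((t : ℕ) : ℤ) - ((s : ℕ) : ℤ)))
      (fun t _ => mul_nonneg (norm_nonneg _) (wt_nonneg _ _)) (Finset.mem_univ s)
    refine le_trans (le_of_eq ?_) this
    simp [wt]
  calc _ ≤ (n : ℝ)⁻¹ * (C * (n : ℝ) ^ S) := by gcongr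
    _ = _ := by rw [Real.rpow_sub_one hn0.ne']; ring

lemma fcT_eq {f : ℝ → ℝ} {σ d : ℝ}
    (hf : ∀ x ∈ Ioc (-π) π, x ≠ 0 →
      f x = σ / (2 * π) * ‖1 - Complex.exp (Complex.I * x)‖ ^ (-(2 * d))) (t : ℤ) :
    fcT f t = (σ : ℂ) * cl d t := by
  unfold fcT cl
  rw [← mul_assoc, ← integral_const_mul]
  refine integral_congr_ae ?_
  filter_upwards [ae_ne_zero] with x hx
  rw [hf x hx.1 hx.2]
  simp only [Gr, Complex.ofReal_one, one_mul]
  push_cast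
  ring

theorem stmt16 (f : Fin 2 → ℝ → ℝ) (σ2 d : Fin 2 → ℝ)
    (hσ2 : ∀ i, 0 < σ2 i) (hd : ∀ i, 0 < d i ∧ d i < 1 / 2)
    (hf : ∀ i, ∀ x ∈ Ioc (-π) π, x ≠ 0 →
      f i x = σ2 i / (2 * π) * ‖1 - Complex.exp (Complex.I * x)‖ ^ (-(2 * d i)))
    (ν : ℕ) (hν : 0 < ν) (hdsum : d 0 + d 1 < 1 / (2 * ν)) :
    ∀ ε > (0 : ℝ),
      (fun n : ℕ =>
        ‖(n : ℂ)⁻¹ * Matrix.trace ((BT n (f 0) * BT n (f 1)) ^ ν)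
          - (((2 * π) ^ (2 * ν - 1) *
              ∫ x in Ioc (-π) π, (f 0 x * f 1 x) ^ ν : ℝ) : ℂ)‖)
        =O[atTop]
          fun n : ℕ => (n : ℝ) ^ (-(1 / (2 * ν) - (d 0 + d 1)) + ε) := by
  intro ε hε
  have hν1 : (1 : ℝ) ≤ ν := by exact_mod_cast hν
  set γ : ℝ := 1 / (2 * ν) - (d 0 + d 1) with hγ
  have hγ0 : 0 < γ := by rw [hγ]; linarith
  have hS : 2 * (ν : ℝ) * (d 0 + d 1) < 1 - γ := by
    have e : 2 * (ν : ℝ) * (d 0 + d 1) = 1 - 2 * ν * γ := by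
      rw [hγ]; field_simp; ring
    rw [e]; nlinarith
  obtain ⟨C, hC, hb⟩ := bound_limit (hd 0).1 (hd 0).2 (hd 1).1 (hd 1).2 ν hS (by linarith)
  have hBT : ∀ (j : Fin 2) (n : ℕ), BT n (f j) = (σ2 j : ℂ) • Tp n (cl (d j)) := by
    intro j n
    ext s t
    exact fcT_eq (hf j) _
  have htr : ∀ n : ℕ, Matrix.trace ((BT n (f 0) * BT n (f 1)) ^ ν) =
      ((σ2 0 * σ2 1 : ℝ) : ℂ) ^ ν *
        Matrix.trace ((Tp n (cl (d 0)) * Tp n (cl (d 1))) ^ ν) := by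
    intro n
    rw [hBT, hBT, Matrix.smul_mul, Matrix.mul_smul, smul_smul, smul_pow, Matrix.trace_smul,
      smul_eq_mul, Complex.ofReal_mul]
  have hIntegral : (2 * π) ^ (2 * ν - 1) * ∫ x in Ioc (-π) π, (f 0 x * f 1 x) ^ ν =
      (σ2 0 * σ2 1) ^ ν * ((2 * π)⁻¹ * ∫ x in Ioc (-π) π, (Gr (d 0) 1 x * Gr (d 1) 1 x) ^ ν) := by
    have e1 : ∫ x in Ioc (-π) π, (f 0 x * f 1 x) ^ ν =
        ∫ x in Ioc (-π) π, (σ2 0 * σ2 1 / (2 * π) ^ 2) ^ ν *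
          (Gr (d 0) 1 x * Gr (d 1) 1 x) ^ ν := by
      refine integral_congr_ae ?_
      filter_upwards [ae_ne_zero] with x hx
      rw [hf 0 x hx.1 hx.2, hf 1 x hx.1 hx.2, ← mul_pow]
      unfold Gr
      simp only [Complex.ofReal_one, one_mul]
      congr 1
      field_simp
    rw [e1, integral_const_mul]
    obtain ⟨k, rfl⟩ : ∃ k, ν = k + 1 := ⟨ν - 1, by omega⟩
    have e2 : 2 * (k + 1) - 1 = 2 * k + 1 := by omega
    have hp : (2 * π) ≠ 0 := by positivity
    rw [e2, div_pow, ← pow_mul]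
    have e3 : (2 * π) ^ (2 * (k + 1)) = (2 * π) ^ (2 * k + 1) * (2 * π) := by ring
    rw [e3]
    field_simp
  have hσ : 0 < σ2 0 * σ2 1 := mul_pos (hσ2 0) (hσ2 1)
  refine IsBigO.of_bound ((σ2 0 * σ2 1) ^ ν * C) ?_
  filter_upwards [eventually_ge_atTop 1] with n hn
  have hn1 : (1 : ℝ) ≤ n := by exact_mod_cast hn
  have hX := hb n hn
  rw [integral_complex_ofReal] at hX
  rw [htr, hIntegral, norm_norm, Real.norm_of_nonneg (by positivity)]
  have e4 : (n : ℂ)⁻¹ * (((σ2 0 * σ2 1 : ℝ) : ℂ) ^ ν *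
        Matrix.trace ((Tp n (cl (d 0)) * Tp n (cl (d 1))) ^ ν)) -
      (((σ2 0 * σ2 1) ^ ν * ((2 * π)⁻¹ *
        ∫ x in Ioc (-π) π, (Gr (d 0) 1 x * Gr (d 1) 1 x) ^ ν) : ℝ) : ℂ) =
      ((σ2 0 * σ2 1 : ℝ) : ℂ) ^ ν * ((n : ℂ)⁻¹ *
        Matrix.trace ((Tp n (cl (d 0)) * Tp n (cl (d 1))) ^ ν) - (2 * π : ℂ)⁻¹ *
        ((∫ x in Ioc (-π) π, (Gr (d 0) 1 x * Gr (d 1) 1 x) ^ ν : ℝ) : ℂ)) := by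
    generalize (∫ x in Ioc (-π) π, (Gr (d 0) 1 x * Gr (d 1) 1 x) ^ ν) = J
    simp only [Complex.ofReal_mul, Complex.ofReal_pow, Complex.ofReal_inv, Complex.ofReal_ofNat]
    ring
  rw [e4, norm_mul, norm_pow, Complex.norm_of_nonneg hσ.le, mul_assoc]
  refine mul_le_mul_of_nonneg_left (hX.trans ?_) (by positivity)
  exact mul_le_mul_of_nonneg_left
    (Real.rpow_le_rpow_of_exponent_le hn1 (by linarith)) hC
end
end

section
/- Let f(λ) = C·|λ|^{−2α}(1 + λ²)^{−β} for λ ∈ ℝ\{0}, with constants C > 0, 0 < α < 1/2 and β > 1/2, and let r(t) = ∫_ℝ e^{iλt} f(λ) dλ be its Fourier transform. Then r(t) = t^{2α−1} · [πC / (cos(πα) Γ(2α))] · (1 + o(1)) as t → +∞, i.e. t^{1−2α} r(t) → πC / (cos(πα) Γ(2α)); here Γ is the Gamma function. -/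
open MeasureTheory Filter Set Asymptotics Real
open scoped ENNReal Topology

noncomputable section

/-- Fourier transform of an integrable function on ℝ. -/
def hatR (h : ℝ → ℝ) (t : ℝ) : ℂ :=
  ∫ x : ℝ, Complex.exp (Complex.I * x * t) * (h x)

lemma aux_int_f {α β : ℝ} (hα : 0 < α ∧ α < 1 / 2) (hβ : 1 / 2 < β) :
    Integrable (fun x : ℝ => |x| ^ (-(2 * α)) * (1 + x ^ 2) ^ (-β)) := by
  have h1 : Integrable (fun x : ℝ => (1 + x ^ 2) ^ (-β)) := by
    have := integrable_rpow_neg_one_add_norm_sq (E := ℝ) (μ := volume) (r := 2 * β)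
      (by simp; linarith)
    refine this.congr (Eventually.of_forall fun x => ?_)
    simp only [Real.norm_eq_abs, sq_abs]
    congr 1; ring
  have hm : Measurable (fun x : ℝ => |x| ^ (-(2 * α)) * (1 + x ^ 2) ^ (-β)) := by fun_prop
  have h2 : IntegrableOn (fun x : ℝ => |x| ^ (-(2 * α)) * (1 + x ^ 2) ^ (-β)) (Ioi 0) := by
    rw [← Ioc_union_Ioi_eq_Ioi (zero_le_one' ℝ), integrableOn_union]
    constructor
    · have h3 : IntegrableOn (fun x : ℝ => x ^ (-(2 * α))) (Ioc 0 1) :=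
        (intervalIntegrable_iff_integrableOn_Ioc_of_le zero_le_one).1
          (intervalIntegral.intervalIntegrable_rpow' (by linarith))
      refine Integrable.mono' h3 hm.aestronglyMeasurable ?_
      filter_upwards [ae_restrict_mem measurableSet_Ioc] with x hx
      have hx0 := hx.1
      rw [Real.norm_of_nonneg (by positivity), abs_of_pos hx.1]
      apply mul_le_of_le_one_right (by positivity)
      exact Real.rpow_le_one_of_one_le_of_nonpos (by nlinarith) (by linarith)
    · refine Integrable.mono' h1.integrableOn hm.aestronglyMeasurable ?_
      filter_upwards [ae_restrict_mem measurableSet_Ioi] with x hx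
      have hx0 : (1:ℝ) < x := hx
      rw [Real.norm_of_nonneg (by positivity), abs_of_pos (by linarith)]
      apply mul_le_of_le_one_left (by positivity)
      exact Real.rpow_le_one_of_one_le_of_nonpos hx0.le (by linarith)
  rw [← integrableOn_univ, ← Iic_union_Ioi (a := (0:ℝ)), integrableOn_union]
  refine ⟨?_, h2⟩
  have h4 := integrableOn_Ici_iff_integrableOn_Ioi (f := fun x : ℝ => |x| ^ (-(2 * α)) * (1 + x ^ 2) ^ (-β)) (μ := volume) (b := 0) |>.2 h2
  have := h4
  rw [← neg_zero] at this
  simpa using this.comp_neg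

/-- dominating function -/
lemma aux_dom {α : ℝ} (hα : 0 < α ∧ α < 1 / 2) :
    IntegrableOn (fun v : ℝ => v ^ (α - 1) * min 3 (2 * v ^ (-(1/2) : ℝ))) (Ioi 0) := by
  have hm : Measurable (fun v : ℝ => v ^ (α - 1) * min 3 (2 * v ^ (-(1/2) : ℝ))) := by fun_prop
  rw [← Ioc_union_Ioi_eq_Ioi (zero_le_one' ℝ), integrableOn_union]
  constructor
  · have h3 : IntegrableOn (fun x : ℝ => x ^ (α - 1)) (Ioc 0 1) :=
      (intervalIntegrable_iff_integrableOn_Ioc_of_le zero_le_one).1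
        (intervalIntegral.intervalIntegrable_rpow' (by linarith))
    refine Integrable.mono' (h3.mul_const 3) hm.aestronglyMeasurable ?_
    filter_upwards [ae_restrict_mem measurableSet_Ioc] with x hx
    have hx0 := hx.1
    rw [Real.norm_of_nonneg (by positivity)]
    gcongr
    exact min_le_left _ _
  · have h3 : IntegrableOn (fun x : ℝ => x ^ (α - 3/2)) (Ioi 1) :=
      integrableOn_Ioi_rpow_of_lt (by linarith) one_pos
    refine Integrable.mono' (h3.mul_const 2) hm.aestronglyMeasurable ?_
    filter_upwards [ae_restrict_mem measurableSet_Ioi] with x hx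
    have hx0 : 0 < x := zero_lt_one.trans hx
    rw [Real.norm_of_nonneg (by positivity)]
    have : x ^ (α - 3/2) * 2 = x ^ (α - 1) * (2 * x ^ (-(1/2) : ℝ)) := by
      rw [show α - 3/2 = (α - 1) + (-(1/2)) by ring, rpow_add hx0]; ring
    rw [this]
    gcongr
    exact min_le_right _ _

def GG (w : ℝ) : ℝ := √(π / w) * rexp (-1 / (4 * w))

lemma GG_bound {v w : ℝ} (hv : 0 < v) (hw : v ≤ w) :
    GG w ≤ min 3 (2 * v ^ (-(1/2) : ℝ)) := by
  have hw0 : 0 < w := hv.trans_le hw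
  have hpi := Real.pi_lt_d2
  refine le_min ?_ ?_
  · unfold GG
    have : rexp (-1 / (4 * w)) = (rexp (1 / (4 * w)))⁻¹ := by rw [← Real.exp_neg]; congr 1; ring
    rw [this, ← div_eq_mul_inv, div_le_iff₀ (Real.exp_pos _)]
    apply Real.sqrt_le_iff.2 ⟨by positivity, ?_⟩
    rw [mul_pow, ← Real.exp_nat_mul]
    have h1 := Real.add_one_le_exp (((2:ℕ):ℝ) * (1 / (4 * w)))
    have h2 : ((2:ℕ):ℝ) * (1 / (4 * w)) = (1/w) / 2 := by push_cast; field_simp; norm_num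
    rw [h2] at h1 ⊢
    have h3 : 0 < 1 / w := by positivity
    have : π / w = π * (1 / w) := by ring
    rw [this]
    nlinarith
  · unfold GG
    calc √(π / w) * rexp (-1 / (4 * w)) ≤ √(π / w) * 1 := by
          gcongr
          apply Real.exp_le_one_iff.2
          apply div_nonpos_of_nonpos_of_nonneg <;> linarith
      _ ≤ √(π / v) := by rw [mul_one]; gcongr
      _ ≤ _ := by
        rw [Real.rpow_neg hv.le, ← Real.sqrt_eq_rpow, Real.sqrt_div pi_nonneg, div_eq_mul_inv]
        gcongr
        apply Real.sqrt_le_iff.2 ⟨by positivity, by linarith⟩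

lemma GG_cont {w : ℝ} (hw : 0 < w) : ContinuousAt GG w := by
  unfold GG
  have : w ≠ 0 := hw.ne'
  have : 4 * w ≠ 0 := by positivity
  fun_prop (disch := assumption)

lemma GG_meas : Measurable GG := by unfold GG; fun_prop

lemma GG_nonneg (w : ℝ) : 0 ≤ GG w := by unfold GG; positivity

/-- limit integral -/
lemma aux_lim {α : ℝ} (hα : 0 < α ∧ α < 1 / 2) :
    ∫ v in Ioi (0:ℝ), v ^ (α - 1) * GG v = √π * (4 ^ (1/2 - α) * Real.Gamma (1/2 - α)) := by
  have h := Real.integral_rpow_mul_exp_neg_mul_Ioi (a := 1/2 - α) (r := 1/4) (by linarith) (by norm_num)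
  rw [show (1:ℝ) / (1/4) = 4 by norm_num] at h
  rw [← h, ← integral_comp_rpow_Ioi _ (p := -1) (by norm_num), ← integral_const_mul]
  refine setIntegral_congr_fun measurableSet_Ioi fun v hv => ?_
  have hv0 : 0 < v := hv
  simp only [GG, smul_eq_mul]
  have e0 : √(π / v⁻¹) = √π * v ^ (1/2 : ℝ) := by
    rw [div_inv_eq_mul, Real.sqrt_mul pi_nonneg, ← Real.sqrt_eq_rpow v]
  rw [Real.rpow_neg_one, Real.inv_rpow hv0.le, ← Real.rpow_neg hv0.le, e0]
  have e : -1 / (4 * v⁻¹) = -(1/4 * v) := by field_simp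
  rw [e]
  have : v ^ (-1 - 1 : ℝ) * v ^ (-(α - 1)) * v ^ (1/2 : ℝ) = v ^ (1/2 - α - 1) := by
    rw [← rpow_add hv0, ← rpow_add hv0]; congr 1; ring
  simp only [abs_neg, abs_one, one_mul]
  linear_combination (√π * rexp (-(1/4 * v))) * this

lemma aux_const {α : ℝ} (hα : 0 < α ∧ α < 1 / 2) :
    √π * (4 ^ (1/2 - α) * Real.Gamma (1/2 - α)) / Real.Gamma α
      = π / (Real.cos (π * α) * Real.Gamma (2 * α)) := by
  have h1 := Real.Gamma_mul_Gamma_add_half α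
  have h2 := Real.Gamma_mul_Gamma_one_sub (α + 1/2)
  rw [show π * (α + 1/2) = π * α + π / 2 by ring, Real.sin_add_pi_div_two,
    show 1 - (α + 1/2) = 1/2 - α by ring] at h2
  have hc : 0 < Real.cos (π * α) := Real.cos_pos_of_mem_Ioo ⟨by nlinarith [pi_pos], by nlinarith [pi_pos]⟩
  have g1 := Real.Gamma_pos_of_pos hα.1
  have g2 : 0 < Real.Gamma (2 * α) := Real.Gamma_pos_of_pos (by linarith)
  have g3 : 0 < Real.Gamma (α + 1/2) := Real.Gamma_pos_of_pos (by linarith)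
  have h4 : (4:ℝ) ^ (1/2 - α) = 2 ^ (1 - 2 * α) := by
    rw [show (4:ℝ) = 2 ^ (2:ℝ) by norm_num, ← Real.rpow_mul (by norm_num)]; congr 1; ring
  rw [h4, div_eq_div_iff g1.ne' (by positivity)]
  rw [eq_div_iff hc.ne'] at h2
  linear_combination (-Real.Gamma (1/2-α) * Real.cos (π * α)) * h1 + Real.Gamma α * h2

def KK (α β : ℝ) (p : ℝ × ℝ) : ℝ := p.1 ^ (α - 1) * (p.2 ^ (β - 1) * rexp (-p.2))

abbrev MM : Measure (ℝ × ℝ) := (volume.restrict (Ioi (0:ℝ))).prod (volume.restrict (Ioi (0:ℝ)))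

lemma ae_MM : ∀ᵐ p ∂MM, 0 < p.1 ∧ 0 < p.2 := by
  unfold MM
  rw [Measure.prod_restrict]
  filter_upwards [ae_restrict_mem (measurableSet_Ioi.prod measurableSet_Ioi)] with p hp
  exact hp

lemma KK_meas (α β : ℝ) : Measurable (KK α β) := by unfold KK; fun_prop

lemma gamma_integrable {a r : ℝ} (ha : 0 < a) (hr : 0 < r) :
    IntegrableOn (fun t : ℝ => t ^ (a - 1) * rexp (-(r * t))) (Ioi 0) := by
  apply Integrable.of_integral_ne_zero
  rw [Real.integral_rpow_mul_exp_neg_mul_Ioi ha hr]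
  have := Real.Gamma_pos_of_pos ha
  positivity

lemma KK_split (α β t x : ℝ) (p : ℝ × ℝ) : KK α β p * rexp (-(t^2 * p.1 + p.2) * x^2) =
    (p.1 ^ (α - 1) * rexp (-((t^2*x^2) * p.1))) * (p.2 ^ (β - 1) * rexp (-((1 + x^2) * p.2))) := by
  unfold KK
  have : rexp (-p.2) * rexp (-(t^2 * p.1 + p.2) * x^2) =
      rexp (-((t^2*x^2) * p.1)) * rexp (-((1 + x^2) * p.2)) := by
    rw [← Real.exp_add, ← Real.exp_add]; congr 1; ring
  linear_combination (p.1 ^ (α - 1) * p.2 ^ (β - 1)) * this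

lemma inner_integrable {α β t x : ℝ} (hα : 0 < α) (hβ : 0 < β) (ht : 0 < t) (hx : x ≠ 0) :
    Integrable (fun p => KK α β p * rexp (-(t^2 * p.1 + p.2) * x^2)) MM := by
  simp only [KK_split]
  exact (gamma_integrable hα (by positivity)).mul_prod (gamma_integrable hβ (by positivity))

lemma inner_integral {α β t x : ℝ} (hα : 0 < α) (hβ : 0 < β) (ht : 0 < t) (hx : x ≠ 0) :
    ∫ p, KK α β p * rexp (-(t^2 * p.1 + p.2) * x^2) ∂MM =
    t ^ (-(2 * α)) * (Real.Gamma α * Real.Gamma β) * (|x| ^ (-(2 * α)) * (1 + x ^ 2) ^ (-β)) := by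
  simp only [KK_split]
  rw [integral_prod_mul (fun v : ℝ => v ^ (α - 1) * rexp (-((t^2*x^2) * v)))
    (fun v : ℝ => v ^ (β - 1) * rexp (-((1 + x^2) * v))),
    Real.integral_rpow_mul_exp_neg_mul_Ioi hα (by positivity),
    Real.integral_rpow_mul_exp_neg_mul_Ioi hβ (by positivity)]
  have hx' : 0 < |x| := abs_pos.2 hx
  rw [one_div, one_div, Real.inv_rpow (by positivity), Real.inv_rpow (by positivity),
    ← Real.rpow_neg (by positivity), ← Real.rpow_neg (by positivity), ← sq_abs x, ← mul_pow,
    ← Real.rpow_natCast (t * |x|), ← Real.rpow_mul (by positivity), Real.mul_rpow ht.le hx'.le]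
  rw [show ((2:ℕ):ℝ) * -α = -(2 * α) by push_cast; ring]
  ring

lemma gauss_ft {t w : ℝ} (hw : 0 < w) :
    ∫ x : ℝ, Complex.exp (Complex.I * x * t) * (rexp (-w * x^2) : ℂ) =
      ((√(π / w) * rexp (-t^2 / (4 * w)) : ℝ) : ℂ) := by
  have := fourierIntegral_gaussian (b := (w : ℂ)) (by simpa using hw) (t : ℂ)
  push_cast
  rw [Real.sqrt_eq_rpow, Complex.ofReal_cpow (by positivity)]
  push_cast
  rw [← this]
  congr 1; ext x; ring_nf

lemma key {C α β t : ℝ} (hα : 0 < α ∧ α < 1 / 2) (hβ : 1 / 2 < β) (ht : 0 < t)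
    (f : ℝ → ℝ)
    (hf : ∀ x : ℝ, x ≠ 0 → f x = C * |x| ^ (-(2 * α)) * (1 + x ^ 2) ^ (-β)) :
    ((t ^ (1 - 2 * α) : ℝ) : ℂ) * hatR f t =
      ((C / (Real.Gamma α * Real.Gamma β) * ∫ p, KK α β p * GG (p.1 + p.2 / t^2) ∂MM : ℝ) : ℂ) := by
  have hβ0 : 0 < β := by linarith
  have g1 := Real.Gamma_pos_of_pos hα.1
  have g2 := Real.Gamma_pos_of_pos hβ0
  have hne : ∀ᵐ x : ℝ, x ≠ 0 := by simp [ae_iff]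
  set F : ℝ → ℝ × ℝ → ℂ := fun x p => Complex.exp (Complex.I * x * t) *
    ((KK α β p * rexp (-(t^2 * p.1 + p.2) * x^2) : ℝ) : ℂ) with hF
  have hKm := KK_meas α β
  have hnorm : ∀ x : ℝ, ‖Complex.exp (Complex.I * x * t)‖ = 1 := by
    intro x
    rw [show Complex.I * x * t = ((x * t : ℝ) : ℂ) * Complex.I by push_cast; ring,
      Complex.norm_exp_ofReal_mul_I]
  have hint : Integrable (Function.uncurry F) (volume.prod MM) := by
    have hmeas : Measurable (Function.uncurry F) := by
      simp only [hF, Function.uncurry_def]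
      fun_prop
    rw [integrable_prod_iff hmeas.aestronglyMeasurable]
    constructor
    · filter_upwards [hne] with x hx
      simp only [Function.uncurry, hF]
      exact ((inner_integrable hα.1 hβ0 ht hx).ofReal).const_mul _
    · refine ((aux_int_f hα hβ).const_mul (t ^ (-(2 * α)) * (Real.Gamma α * Real.Gamma β))).congr ?_
      filter_upwards [hne] with x hx
      rw [← inner_integral hα.1 hβ0 ht hx]
      apply integral_congr_ae
      filter_upwards [ae_MM] with p hp
      obtain ⟨hp1, hp2⟩ := hp
      simp only [Function.uncurry, hF]
      rw [norm_mul, hnorm, one_mul, Complex.norm_real, Real.norm_of_nonneg]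
      unfold KK
      positivity
  have hswap := integral_integral_swap hint
  have hL : ∫ x, ∫ p, F x p ∂MM =
      ((t ^ (-(2 * α)) * (Real.Gamma α * Real.Gamma β) : ℝ) : ℂ) * ∫ x : ℝ, Complex.exp (Complex.I * x * t) *
        ((|x| ^ (-(2 * α)) * (1 + x ^ 2) ^ (-β) : ℝ) : ℂ) := by
    rw [← integral_const_mul]
    apply integral_congr_ae
    filter_upwards [hne] with x hx
    simp only [hF]
    rw [integral_const_mul, integral_complex_ofReal, inner_integral hα.1 hβ0 ht hx]
    push_cast
    ring
  have hR : ∫ p, (∫ x, F x p) ∂MM = ((t⁻¹ * ∫ p, KK α β p * GG (p.1 + p.2 / t^2) ∂MM : ℝ) : ℂ) := by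
    rw [← integral_const_mul, ← integral_complex_ofReal]
    apply integral_congr_ae
    filter_upwards [ae_MM] with p hp
    obtain ⟨hp1, hp2⟩ := hp
    have hw : 0 < t^2 * p.1 + p.2 := by positivity
    have e : ∀ x : ℝ, F x p = (KK α β p : ℂ) * (Complex.exp (Complex.I * x * t) *
        (rexp (-(t^2 * p.1 + p.2) * x^2) : ℂ)) := by
      intro x; simp only [hF]; push_cast; ring
    simp only [e]
    rw [integral_const_mul, gauss_ft hw, ← Complex.ofReal_mul]
    congr 1
    unfold GG
    have e1 : p.1 + p.2 / t^2 = (t^2 * p.1 + p.2) / t^2 := by field_simp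
    have e2 : √(π / (p.1 + p.2 / t^2)) = t * √(π / (t^2 * p.1 + p.2)) := by
      rw [e1, ← Real.sqrt_sq ht.le, ← Real.sqrt_mul (by positivity), Real.sqrt_sq ht.le]
      congr 1; field_simp
    have e3 : -1 / (4 * (p.1 + p.2 / t^2)) = -t^2 / (4 * (t^2 * p.1 + p.2)) := by
      rw [e1]; field_simp
    rw [e2, e3]
    field_simp
  have hh : hatR f t = (C : ℂ) * ∫ x : ℝ, Complex.exp (Complex.I * x * t) *
        ((|x| ^ (-(2 * α)) * (1 + x ^ 2) ^ (-β) : ℝ) : ℂ) := by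
    unfold hatR
    rw [← integral_const_mul]
    apply integral_congr_ae
    filter_upwards [hne] with x hx
    rw [hf x hx]
    push_cast
    ring
  rw [hL, hR] at hswap
  rw [hh]
  set J := ∫ x : ℝ, Complex.exp (Complex.I * x * t) *
        ((|x| ^ (-(2 * α)) * (1 + x ^ 2) ^ (-β) : ℝ) : ℂ)
  set L := ∫ p, KK α β p * GG (p.1 + p.2 / t^2) ∂MM
  have hΓ : (Real.Gamma α * Real.Gamma β) ≠ 0 := by positivity
  have hcoef : t ^ (1 - 2 * α) * C = C / (Real.Gamma α * Real.Gamma β) * t *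
      (t ^ (-(2 * α)) * (Real.Gamma α * Real.Gamma β)) := by
    rw [show 1 - 2 * α = 1 + -(2 * α) by ring, rpow_add ht, rpow_one]
    field_simp
  calc ((t ^ (1 - 2 * α) : ℝ) : ℂ) * (C * J) = ((t ^ (1 - 2 * α) * C : ℝ) : ℂ) * J := by
        push_cast; ring
    _ = ((C / (Real.Gamma α * Real.Gamma β) * t : ℝ) : ℂ) * (((t⁻¹ * L : ℝ)) : ℂ) := by
        rw [hcoef, ← hswap]; push_cast; ring
    _ = _ := by
        rw [← Complex.ofReal_mul]; congr 1; field_simp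

lemma lim {α β : ℝ} (hα : 0 < α ∧ α < 1 / 2) (hβ : 1 / 2 < β) :
    Tendsto (fun t : ℝ => ∫ p, KK α β p * GG (p.1 + p.2 / t^2) ∂MM) atTop
      (𝓝 (∫ p, KK α β p * GG p.1 ∂MM)) := by
  have hKm := KK_meas α β
  have hGm := GG_meas
  have hβ0 : 0 < β := by linarith
  refine tendsto_integral_filter_of_dominated_convergence
    (fun p => (p.1 ^ (α - 1) * min 3 (2 * p.1 ^ (-(1/2) : ℝ))) * (p.2 ^ (β - 1) * rexp (-(1 * p.2))))
    ?_ ?_ ?_ ?_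
  · refine Eventually.of_forall fun t => Measurable.aestronglyMeasurable ?_
    fun_prop
  · filter_upwards [eventually_gt_atTop 0] with t ht
    filter_upwards [ae_MM] with p hp
    obtain ⟨hp1, hp2⟩ := hp
    have hb := GG_bound hp1 (w := p.1 + p.2 / t^2) (by have : 0 < p.2 / t^2 := by positivity
                                                       linarith)
    have h0 := GG_nonneg (p.1 + p.2 / t^2)
    rw [Real.norm_of_nonneg (by unfold KK; positivity)]
    unfold KK
    rw [one_mul, mul_right_comm]
    gcongr
  · exact (aux_dom hα).mul_prod (gamma_integrable hβ0 one_pos)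
  · filter_upwards [ae_MM] with p hp
    refine Tendsto.const_mul _ ?_
    refine (GG_cont hp.1).tendsto.comp ?_
    have : Tendsto (fun t : ℝ => p.2 / t^2) atTop (𝓝 0) :=
      tendsto_const_nhds.div_atTop (tendsto_pow_atTop (by norm_num))
    simpa using tendsto_const_nhds.add this

lemma lim_val {α β : ℝ} (hα : 0 < α ∧ α < 1 / 2) (hβ : 1 / 2 < β) :
    ∫ p, KK α β p * GG p.1 ∂MM =
      (√π * (4 ^ (1/2 - α) * Real.Gamma (1/2 - α))) * Real.Gamma β := by
  have e : ∀ p : ℝ × ℝ, KK α β p * GG p.1 =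
      (p.1 ^ (α - 1) * GG p.1) * (p.2 ^ (β - 1) * rexp (-(1 * p.2))) := by
    intro p; unfold KK; rw [one_mul]; ring
  simp only [e]
  rw [integral_prod_mul (fun v : ℝ => v ^ (α - 1) * GG v)
    (fun v : ℝ => v ^ (β - 1) * rexp (-(1 * v))), aux_lim hα,
    Real.integral_rpow_mul_exp_neg_mul_Ioi (by linarith) one_pos]
  simp

theorem stmt18 (C α β : ℝ) (hC : 0 < C) (hα : 0 < α ∧ α < 1 / 2) (hβ : 1 / 2 < β)
    (f : ℝ → ℝ)
    (hf : ∀ x : ℝ, x ≠ 0 → f x = C * |x| ^ (-(2 * α)) * (1 + x ^ 2) ^ (-β)) :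
    Tendsto (fun t : ℝ => ((t ^ (1 - 2 * α) : ℝ) : ℂ) * hatR f t) atTop
      (nhds ((π * C / (Real.cos (π * α) * Real.Gamma (2 * α)) : ℝ) : ℂ)) := by
  have g2 : 0 < Real.Gamma β := Real.Gamma_pos_of_pos (by linarith)
  have g1 := Real.Gamma_pos_of_pos hα.1
  have h := (lim hα hβ).const_mul (C / (Real.Gamma α * Real.Gamma β))
  have hc : C / (Real.Gamma α * Real.Gamma β) * ∫ p, KK α β p * GG p.1 ∂MM =
      π * C / (Real.cos (π * α) * Real.Gamma (2 * α)) := by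
    rw [lim_val hα hβ, mul_comm π C, mul_div_assoc C π, ← aux_const hα]
    field_simp
  rw [hc] at h
  have h' := (Complex.continuous_ofReal.tendsto _).comp h
  refine h'.congr' ?_
  filter_upwards [eventually_gt_atTop 0] with t ht
  exact (key hα hβ ht f hf).symm
end
end
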